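/- (Putinar's Positivstellensatz) Let u_1, …, u_m be real polynomials in n variables and let K = {x ∈ ℝ^n : u_1(x) ≥ 0, …, u_m(x) ≥ 0} be compact. Let M be the quadratic module M = {σ_0 + Σ_{j=1}^m σ_j u_j : σ_0, σ_j are sum-of-squares polynomials}. Suppose there exists a polynomial u ∈ M such that the set {x ∈ ℝ^n : u(x) ≥ 0} is compact. If a real polynomial p satisfies p(x) > 0 for all x ∈ K, then p ∈ M. -/

import Mathlib

/-- A real polynomial in `n` variables is a sum of squares (SOS) if it is a
finite sum of squares of polynomials. -/
def IsSOS {n : ℕ} (p : MvPolynomial (Fin n) ℝ) : Prop :=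
  ∃ (r : ℕ) (h : Fin r → MvPolynomial (Fin n) ℝ), p = ∑ i, (h i) ^ 2

/-- Intermediate value property for polynomials. -/
def PIVT (K : Type*) [Field K] [LinearOrder K] : Prop :=
  ∀ (P : Polynomial K) (a b : K), a < b → P.eval a * P.eval b < 0 →
    ∃ c, a < c ∧ c < b ∧ P.eval c = 0

section RC
open Polynomial
variable {K : Type*} [Field K] [LinearOrder K] [IsStrictOrderedRing K]

lemma PIVT.pos_of_no_root (hK : PIVT K) {P : K[X]} {a b : K} (hab : a ≤ b)
    (ha : P.eval a ≠ 0) (hb : P.eval b ≠ 0)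
    (h : ∀ c, a < c → c < b → P.eval c ≠ 0) : 0 < P.eval a * P.eval b := by
  rcases hab.eq_or_lt with rfl | hlt
  · exact mul_self_pos.2 ha
  · by_contra hn
    have : P.eval a * P.eval b < 0 :=
      lt_of_le_of_ne (not_lt.1 hn) (mul_ne_zero ha hb)
    obtain ⟨c, h1, h2, h3⟩ := hK P a b hlt this
    exact h c h1 h2 h3

/-- Rolle between consecutive roots. -/
lemma PIVT.rolle_aux (hK : PIVT K) {P : K[X]} (hP : P ≠ 0) {a b : K} (hab : a < b)
    (ha : P.eval a = 0) (hb : P.eval b = 0)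
    (h : ∀ c, a < c → c < b → P.eval c ≠ 0) :
    ∃ c, a < c ∧ c < b ∧ P.derivative.eval c = 0 := by
  obtain ⟨Q, hQ, hQa⟩ := exists_eq_pow_rootMultiplicity_mul_and_not_dvd P hP a
  have hm : 0 < P.rootMultiplicity a := (rootMultiplicity_pos hP).2 ha
  obtain ⟨m, hm'⟩ : ∃ m, P.rootMultiplicity a = m + 1 := ⟨_, (Nat.succ_pred_eq_of_pos hm).symm⟩
  rw [hm'] at hQ
  have hQ0 : Q ≠ 0 := by rintro rfl; simp at hQa
  have hQb : Q.eval b = 0 := by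
    rw [hQ] at hb
    simp only [eval_mul, eval_pow, eval_sub, eval_X, eval_C, mul_eq_zero] at hb
    rcases hb with hb | hb
    · exact absurd (pow_eq_zero_iff (by simp) |>.1 hb) (sub_pos.2 hab).ne'
    · exact hb
  obtain ⟨R, hR, hRb⟩ := exists_eq_pow_rootMultiplicity_mul_and_not_dvd Q hQ0 b
  have hk : 0 < Q.rootMultiplicity b := (rootMultiplicity_pos hQ0).2 hQb
  obtain ⟨k, hk'⟩ : ∃ m, Q.rootMultiplicity b = m + 1 := ⟨_, (Nat.succ_pred_eq_of_pos hk).symm⟩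
  rw [hk'] at hR
  have hPR : P = (X - C a) ^ (m + 1) * ((X - C b) ^ (k + 1) * R) := by rw [← hR]; exact hQ
  have hRb' : R.eval b ≠ 0 := fun h => hRb (dvd_iff_isRoot.2 h)
  have hRa' : R.eval a ≠ 0 := fun h => hQa (by
    rw [hR]; exact (dvd_iff_isRoot.2 h).mul_left _)
  have hRc : ∀ c, a < c → c < b → R.eval c ≠ 0 := fun c h1 h2 h3 => h c h1 h2 (by
    rw [hPR]; simp [h3])
  have hpos := hK.pos_of_no_root hab.le hRa' hRb' hRc
  set S : K[X] := C ((m : K) + 1) * (X - C b) * R + C ((k : K) + 1) * (X - C a) * R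
    + (X - C a) * (X - C b) * derivative R with hS
  have hder : derivative P = (X - C a) ^ m * (X - C b) ^ k * S := by
    rw [hPR, hS]
    simp only [derivative_mul, derivative_X_sub_C_pow, map_add, map_one, map_natCast, Nat.cast_add, Nat.cast_one, Nat.add_sub_cancel]
    ring
  have hneg : S.eval a * S.eval b < 0 := by
    have e : S.eval a * S.eval b
        = -(((m : K) + 1) * ((k : K) + 1) * (b - a) ^ 2 * (R.eval a * R.eval b)) := by
      simp [hS]; ring
    rw [e, neg_lt_zero]
    have := sub_pos.2 hab
    positivity
  obtain ⟨c, h1, h2, h3⟩ := hK S a b hab hneg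
  exact ⟨c, h1, h2, by rw [hder]; simp [h3]⟩

lemma PIVT.rolle (hK : PIVT K) {P : K[X]} {a b : K} (hab : a < b)
    (ha : P.eval a = 0) (hb : P.eval b = 0) :
    ∃ c, a < c ∧ c < b ∧ P.derivative.eval c = 0 := by
  classical
  by_cases hP : P = 0
  · obtain ⟨c, h1, h2⟩ := exists_between hab
    exact ⟨c, h1, h2, by simp [hP]⟩
  -- smallest root greater than a
  let s := P.roots.toFinset.filter (fun x => a < x)
  have hbs : b ∈ s := by simp [s, hP, hb, hab]
  obtain ⟨b', hb', hmin⟩ := s.exists_min_image id ⟨b, hbs⟩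
  simp only [s, Finset.mem_filter, Multiset.mem_toFinset, mem_roots hP, IsRoot.def, id] at hb' hmin
  obtain ⟨c, h1, h2, h3⟩ := hK.rolle_aux hP hb'.2 ha hb'.1 (fun c h1 h2 h3 =>
    absurd (hmin c ⟨h3, h1⟩) (not_le.2 h2))
  exact ⟨c, h1, h2.trans_le (hmin b ⟨hb, hab⟩), h3⟩

lemma PIVT.mvt (hK : PIVT K) (P : K[X]) {a b : K} (hab : a < b) :
    ∃ c, a < c ∧ c < b ∧ P.eval b - P.eval a = P.derivative.eval c * (b - a) := by
  have hne : b - a ≠ 0 := (sub_pos.2 hab).ne'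
  obtain ⟨c, h1, h2, h3⟩ := hK.rolle
    (P := C (b - a) * (P - C (P.eval a)) - C (P.eval b - P.eval a) * (X - C a)) hab
    (by simp) (by simp; ring)
  refine ⟨c, h1, h2, ?_⟩
  simp at h3
  linear_combination -h3

/-- No critical points: sign of slope is constant. -/
lemma PIVT.mono (hK : PIVT K) (P : K[X]) {a b : K}
    (h : ∀ c, a < c → c < b → P.derivative.eval c ≠ 0) {x y u v : K}
    (hx : a ≤ x) (hxy : x < y) (hy : y ≤ b) (hu : a ≤ u) (huv : u < v) (hv : v ≤ b) :
    0 < (P.eval y - P.eval x) * (P.eval v - P.eval u) := by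
  obtain ⟨c, c1, c2, c3⟩ := hK.mvt P hxy
  obtain ⟨d, d1, d2, d3⟩ := hK.mvt P huv
  have hc1 := hx.trans_lt c1
  have hc2 := c2.trans_le hy
  have hd1 := hu.trans_lt d1
  have hd2 := d2.trans_le hv
  have : 0 < P.derivative.eval c * P.derivative.eval d := by
    rcases le_total c d with hcd | hcd
    · exact hK.pos_of_no_root hcd (h c hc1 hc2) (h d hd1 hd2)
        (fun e h1 h2 => h e (hc1.trans h1) (h2.trans hd2))
    · rw [mul_comm]
      exact hK.pos_of_no_root hcd (h d hd1 hd2) (h c hc1 hc2)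
        (fun e h1 h2 => h e (hd1.trans h1) (h2.trans hc2))
  rw [c3, d3]
  have e1 := sub_pos.2 hxy
  have e2 := sub_pos.2 huv
  have : 0 < (P.derivative.eval c * P.derivative.eval d) * ((y - x) * (v - u)) := by positivity
  linarith
end RC

section Core
set_option linter.unusedSectionVars false
open Polynomial
variable {E K₁ K₂ : Type*} [CommRing E]
  [Field K₁] [LinearOrder K₁] [IsStrictOrderedRing K₁]
  [Field K₂] [LinearOrder K₂] [IsStrictOrderedRing K₂]

/-- A field with compatible signs in two ordered fields, maximal as such. -/
structure MaxPair (ψ₁ : E →+* K₁) (ψ₂ : E →+* K₂) : Prop where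
  sgn : ∀ e, SignType.sign (ψ₁ e) = SignType.sign (ψ₂ e)
  inv : ∀ e : E, e ≠ 0 → ∃ e' : E, e * e' = 1
  max : ∀ t₁ t₂, (∀ q : E[X], SignType.sign ((q.map ψ₁).eval t₁)
    = SignType.sign ((q.map ψ₂).eval t₂)) → ∃ e, ψ₁ e = t₁ ∧ ψ₂ e = t₂

variable {ψ₁ : E →+* K₁} {ψ₂ : E →+* K₂}

lemma MaxPair.symm (h : MaxPair ψ₁ ψ₂) : MaxPair ψ₂ ψ₁ where
  sgn e := (h.sgn e).symm
  inv := h.inv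
  max t₁ t₂ hq := by
    obtain ⟨e, h1, h2⟩ := h.max t₂ t₁ (fun q => (hq q).symm)
    exact ⟨e, h2, h1⟩

lemma MaxPair.inj (h : MaxPair ψ₁ ψ₂) : Function.Injective ψ₁ := by
  rw [injective_iff_map_eq_zero]
  intro e he
  by_contra hne
  obtain ⟨e', h'⟩ := h.inv e hne
  have := congrArg ψ₁ h'
  simp [he] at this

lemma MaxPair.lt_iff (h : MaxPair ψ₁ ψ₂) (a b : E) : ψ₁ a < ψ₁ b ↔ ψ₂ a < ψ₂ b := by
  have := h.sgn (b - a)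
  rw [← sub_pos, ← sub_pos (b := ψ₂ a), ← map_sub, ← map_sub, ← sign_eq_one_iff, this,
    sign_eq_one_iff]

lemma MaxPair.le_iff (h : MaxPair ψ₁ ψ₂) (a b : E) : ψ₁ a ≤ ψ₁ b ↔ ψ₂ a ≤ ψ₂ b := by
  rw [← not_lt, ← not_lt, h.lt_iff]

lemma sign_const {K : Type*} [Field K] [LinearOrder K] [IsStrictOrderedRing K]
    (hK : PIVT K) {P : K[X]} (h : ∀ c, P.eval c ≠ 0) (x y : K) :
    SignType.sign (P.eval x) = SignType.sign (P.eval y) := by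
  wlog hxy : x ≤ y generalizing x y
  · exact (this y x (le_of_not_ge hxy)).symm
  have := hK.pos_of_no_root hxy (h x) (h y) (fun c _ _ => h c)
  rcases pos_and_pos_or_neg_and_neg_of_mul_pos this with ⟨h1, h2⟩ | ⟨h1, h2⟩
  · rw [sign_pos h1, sign_pos h2]
  · rw [sign_neg h1, sign_neg h2]

lemma eval_map_hom {E K : Type*} [CommRing E] [CommRing K] (ψ : E →+* K) (q : E[X]) (e : E) :
    (q.map ψ).eval (ψ e) = ψ (q.eval e) := by
  rw [eval_map, eval₂_hom]

lemma MaxPair.sign_lemma (h : MaxPair ψ₁ ψ₂) (h₁ : PIVT K₁) (h₂ : PIVT K₂) :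
    ∀ (d : ℕ) (q : E[X]), q.natDegree = d → q ≠ 0 →
      (∀ t, (q.map ψ₁).eval t = 0 → ∃ e, ψ₁ e = t) →
      (∀ t, (q.map ψ₂).eval t = 0 → ∃ e, ψ₂ e = t) → ∀ t₁ t₂,
      (∀ e, q.eval e = 0 → SignType.sign (t₁ - ψ₁ e) = SignType.sign (t₂ - ψ₂ e)) →
      SignType.sign ((q.map ψ₁).eval t₁) = SignType.sign ((q.map ψ₂).eval t₂) := by
  have : Nontrivial E := ψ₁.domain_nontrivial
  have hinj := h.inj
  have hinj2 := h.symm.inj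
  have : IsDomain E := hinj.isDomain ψ₁
  intro d
  induction d with
  | zero =>
    intro q hq hq0 _ _ t₁ t₂ _
    rw [natDegree_eq_zero] at hq
    obtain ⟨c, rfl⟩ := hq
    simpa using h.sgn c
  | succ d ih =>
    intro q hq hq0 hr1 hr2 t₁ t₂ hcut
    by_cases hex : ∃ e, q.eval e = 0
    · obtain ⟨e, he⟩ := hex
      obtain ⟨q', rfl⟩ := dvd_iff_isRoot.2 he
      have hq'0 : q' ≠ 0 := right_ne_zero_of_mul hq0
      rw [natDegree_mul (X_sub_C_ne_zero e) hq'0, natDegree_X_sub_C] at hq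
      have := ih q' (by omega) hq'0 (fun t ht => hr1 t (by simp [ht]))
        (fun t ht => hr2 t (by simp [ht])) t₁ t₂ (fun e' he' => hcut e' (by simp [he']))
      simp only [Polynomial.map_mul, eval_mul, sign_mul, this]
      congr 1
      simpa using hcut e he
    · push Not at hex
      have e1 : ∀ c, (q.map ψ₁).eval c ≠ 0 := by
        intro c hc
        obtain ⟨e, rfl⟩ := hr1 c hc
        rw [eval_map_hom, map_eq_zero_iff _ hinj] at hc
        exact hex e hc
      have e2 : ∀ c, (q.map ψ₂).eval c ≠ 0 := by
        intro c hc
        obtain ⟨e, rfl⟩ := hr2 c hc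
        rw [eval_map_hom, map_eq_zero_iff _ hinj2] at hc
        exact hex e hc
      rw [sign_const h₁ e1 t₁ (ψ₁ 0), sign_const h₂ e2 t₂ (ψ₂ 0), eval_map_hom, eval_map_hom,
        h.sgn]

lemma root_bound (ψ₁ : E →+* K₁) {P : E[X]} (hP : P.Monic) (hd : P.natDegree ≠ 0) (t : K₁)
    (ht : (P.map ψ₁).eval t = 0) : ∃ B, |t| < ψ₁ B := by
  by_cases h1 : |t| ≤ 1
  · exact ⟨2, by rw [map_ofNat]; exact h1.trans_lt one_lt_two⟩
  push Not at h1
  obtain ⟨k, hk⟩ := Nat.exists_eq_succ_of_ne_zero hd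
  refine ⟨∑ i ∈ Finset.range (k + 1), (P.coeff i ^ 2 + 1) + 1, ?_⟩
  rw [map_add, map_one]
  refine lt_of_le_of_lt ?_ (lt_add_one _)
  have e := ht
  rw [hP.as_sum, hk] at e
  simp only [Polynomial.map_add, Polynomial.map_pow, map_X, Polynomial.map_sum, Polynomial.map_mul, map_C, eval_add,
    eval_pow, eval_X, eval_finsetSum, eval_mul, eval_C] at e
  have e2 : |t| ^ (k + 1) = |∑ i ∈ Finset.range (k + 1), ψ₁ (P.coeff i) * t ^ i| := by
    rw [← abs_pow, eq_neg_of_add_eq_zero_left e, abs_neg]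
  have e3 : |∑ i ∈ Finset.range (k + 1), ψ₁ (P.coeff i) * t ^ i| ≤
      (∑ i ∈ Finset.range (k + 1), ψ₁ (P.coeff i ^ 2 + 1)) * |t| ^ k := by
    rw [Finset.sum_mul]
    refine (Finset.abs_sum_le_sum_abs _ _).trans (Finset.sum_le_sum fun i hi => ?_)
    rw [abs_mul, abs_pow]
    have : i ≤ k := Nat.lt_succ_iff.1 (Finset.mem_range.1 hi)
    have h5 : |ψ₁ (P.coeff i)| ≤ ψ₁ (P.coeff i ^ 2 + 1) := by
      rw [map_add, map_pow, map_one, ← sq_abs]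
      nlinarith [sq_nonneg (|ψ₁ (P.coeff i)| - 1), abs_nonneg (ψ₁ (P.coeff i))]
    exact mul_le_mul h5 (pow_le_pow_right₀ h1.le this) (by positivity)
      ((abs_nonneg _).trans h5)
  rw [map_sum]
  have e4 : |t| * |t| ^ k ≤ (∑ i ∈ Finset.range (k + 1), ψ₁ (P.coeff i ^ 2 + 1)) * |t| ^ k := by
    rw [← pow_succ', e2]; exact e3
  exact le_of_mul_le_mul_right e4 (by positivity)

lemma root_cut {K : Type*} [Field K] [LinearOrder K] [IsStrictOrderedRing K]
    (hK : PIVT K) {P : K[X]} {a b t : K} (hat : a < t) (htb : t < b)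
    (h : ∀ c, a < c → c < b → P.derivative.eval c ≠ 0) (ht : P.eval t = 0)
    {e : K} (hae : a ≤ e) (heb : e ≤ b) :
    SignType.sign (t - e) = SignType.sign (P.eval a * P.eval e) := by
  rcases lt_trichotomy e t with h1 | rfl | h1
  · rw [sign_pos (sub_pos.2 h1), sign_pos]
    have := hK.mono P h le_rfl hat htb.le hae h1 htb.le
    rw [ht] at this; linarith
  · simp [ht]
  · rw [sign_neg (sub_neg.2 h1), sign_neg]
    have := hK.mono P h le_rfl hat htb.le hat.le h1 heb
    rw [ht] at this; linarith

lemma MaxPair.alg_step (h : MaxPair ψ₁ ψ₂) (h₁ : PIVT K₁) (h₂ : PIVT K₂) (d : ℕ)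
    (ih : ∀ q : E[X], q ≠ 0 → q.natDegree < d →
      (∀ t, (q.map ψ₁).eval t = 0 → ∃ e, ψ₁ e = t) ∧
      (∀ t, (q.map ψ₂).eval t = 0 → ∃ e, ψ₂ e = t))
    (P : E[X]) (hP : P ≠ 0) (hd : P.natDegree = d) (t : K₁) (ht : (P.map ψ₁).eval t = 0) :
    ∃ e, ψ₁ e = t := by
  classical
  have : Nontrivial E := ψ₁.domain_nontrivial
  have hinj := h.inj
  have hinj2 := h.symm.inj
  have : IsDomain E := hinj.isDomain ψ₁
  wlog hmon : P.Monic generalizing P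
  · obtain ⟨c, hc⟩ := h.inv _ (leadingCoeff_ne_zero.2 hP)
    have hc0 : c ≠ 0 := by rintro rfl; simp at hc
    refine this (P * C c) (mul_ne_zero hP (C_ne_zero.2 hc0)) ?_ (by simp [ht]) ?_
    · rw [natDegree_mul_C hc0, hd]
    · rw [Monic, leadingCoeff_mul, leadingCoeff_C, hc]
  by_contra hne
  push Not at hne
  have hd0 : P.natDegree ≠ 0 := by
    intro h0
    rw [hmon.natDegree_eq_zero] at h0
    simp [h0] at ht
  have hmin : ∀ q : E[X], q ≠ 0 → q.natDegree < d → (q.map ψ₁).eval t ≠ 0 := by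
    intro q hq hqd hqt
    obtain ⟨e, he⟩ := (ih q hq hqd).1 t hqt
    exact hne e he
  have hnoroot : ∀ e, P.eval e ≠ 0 := by
    intro e he
    obtain ⟨Q, rfl⟩ := dvd_iff_isRoot.2 he
    have hQ0 : Q ≠ 0 := right_ne_zero_of_mul hP
    rw [natDegree_mul (X_sub_C_ne_zero e) hQ0, natDegree_X_sub_C] at hd
    have := hmin Q hQ0 (by omega)
    simp only [Polynomial.map_mul, eval_mul, mul_eq_zero, this, or_false] at ht
    simp at ht
    exact hne e (sub_eq_zero.1 ht).symm
  have hD0 : derivative P ≠ 0 := by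
    intro hD
    have := congrArg (fun q => ψ₁ (coeff q (P.natDegree - 1))) hD
    have e1 : P.natDegree - 1 + 1 = P.natDegree := by omega
    simp only [coeff_derivative, e1, hmon.coeff_natDegree, coeff_zero, map_zero, one_mul, map_add,
      map_natCast, map_one] at this
    norm_cast at this
  have hDd : (derivative P).natDegree < d := hd ▸ natDegree_derivative_lt hd0
  have hD1 : (derivative P).map ψ₁ ≠ 0 := (Polynomial.map_ne_zero_iff hinj).2 hD0
  obtain ⟨B, hB⟩ := root_bound ψ₁ hmon hd0 t ht
  rw [abs_lt] at hB
  let s := ((derivative P).map ψ₁).roots.toFinset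
  have hs : ∀ c, c ∈ s ↔ ((derivative P).map ψ₁).eval c = 0 := by
    intro c; simp [s, mem_roots hD1]
  have hsE : ∀ c ∈ s, ∃ e, ψ₁ e = c := fun c hc => (ih _ hD0 hDd).1 c ((hs c).1 hc)
  obtain ⟨a1, ha1, hamax⟩ := (insert (ψ₁ (-B)) (s.filter (· < t))).exists_max_image id
    ⟨_, Finset.mem_insert_self _ _⟩
  obtain ⟨b1, hb1, hbmin⟩ := (insert (ψ₁ B) (s.filter (t < ·))).exists_min_image id
    ⟨_, Finset.mem_insert_self _ _⟩
  obtain ⟨⟨a, rfl⟩, hat⟩ : (∃ a, ψ₁ a = a1) ∧ a1 < t := by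
    rw [Finset.mem_insert, Finset.mem_filter] at ha1
    rcases ha1 with rfl | ⟨h3, h4⟩
    · exact ⟨⟨_, rfl⟩, by simpa using hB.1⟩
    · exact ⟨hsE _ h3, h4⟩
  obtain ⟨⟨b, rfl⟩, htb⟩ : (∃ a, ψ₁ a = b1) ∧ t < b1 := by
    rw [Finset.mem_insert, Finset.mem_filter] at hb1
    rcases hb1 with rfl | ⟨h3, h4⟩
    · exact ⟨⟨_, rfl⟩, hB.2⟩
    · exact ⟨hsE _ h3, h4⟩
  have hcrit1 : ∀ c, ψ₁ a < c → c < ψ₁ b → (derivative (P.map ψ₁)).eval c ≠ 0 := by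
    intro c hac hcb hc
    rw [derivative_map] at hc
    rcases lt_trichotomy c t with h3 | rfl | h3
    · exact absurd (hamax c (by simp [hs, hc, h3])) (not_le.2 hac)
    · exact hmin _ hD0 hDd hc
    · exact absurd (hbmin c (by simp [hs, hc, h3])) (not_le.2 hcb)
  have hab := (h.lt_iff a b).1 (hat.trans htb)
  have hneg1 : ψ₁ (P.eval a * P.eval b) < 0 := by
    have := h₁.mono (P.map ψ₁) hcrit1 le_rfl hat htb.le hat.le htb le_rfl
    rw [ht, eval_map_hom, eval_map_hom] at this
    rw [map_mul]; linarith
  have hneg2 : (P.map ψ₂).eval (ψ₂ a) * (P.map ψ₂).eval (ψ₂ b) < 0 := by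
    rw [eval_map_hom, eval_map_hom, ← map_mul]
    rw [← sign_eq_neg_one_iff, ← h.sgn, sign_eq_neg_one_iff]; exact hneg1
  obtain ⟨t₂, hat2, htb2, ht2⟩ := h₂ _ _ _ hab hneg2
  have hcrit2 : ∀ c, ψ₂ a < c → c < ψ₂ b → (derivative (P.map ψ₂)).eval c ≠ 0 := by
    intro c hac hcb hc
    rw [derivative_map] at hc
    obtain ⟨e, rfl⟩ := (ih _ hD0 hDd).2 c hc
    rw [← h.lt_iff] at hac hcb
    apply hcrit1 _ hac hcb
    rw [eval_map_hom, map_eq_zero_iff _ hinj2] at hc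
    rw [derivative_map, eval_map_hom, hc, map_zero]
  have hcut : ∀ e, SignType.sign (t - ψ₁ e) = SignType.sign (t₂ - ψ₂ e) := by
    intro e
    by_cases hea : ψ₁ e ≤ ψ₁ a
    · rw [sign_pos (sub_pos.2 (hea.trans_lt hat)),
        sign_pos (sub_pos.2 (((h.le_iff _ _).1 hea).trans_lt hat2))]
    by_cases hbe : ψ₁ b ≤ ψ₁ e
    · rw [sign_neg (sub_neg.2 (htb.trans_le hbe)),
        sign_neg (sub_neg.2 (htb2.trans_le ((h.le_iff _ _).1 hbe)))]
    push Not at hea hbe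
    rw [root_cut h₁ hat htb hcrit1 ht hea.le hbe.le,
      root_cut h₂ hat2 htb2 hcrit2 ht2 ((h.lt_iff _ _).1 hea).le ((h.lt_iff _ _).1 hbe).le,
      eval_map_hom, eval_map_hom, eval_map_hom, eval_map_hom, ← map_mul, ← map_mul, h.sgn]
  obtain ⟨e, he, -⟩ := h.max t t₂ (by
    intro q
    have e1 : (q.map ψ₁).eval t = ((q %ₘ P).map ψ₁).eval t := by
      conv_lhs => rw [← modByMonic_add_div q P]
      simp [ht]
    have e2 : (q.map ψ₂).eval t₂ = ((q %ₘ P).map ψ₂).eval t₂ := by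
      conv_lhs => rw [← modByMonic_add_div q P]
      simp [ht2]
    rw [e1, e2]
    by_cases hr : q %ₘ P = 0
    · simp [hr]
    have hrd : (q %ₘ P).natDegree < d := hd ▸ natDegree_modByMonic_lt q hmon (by
      rintro rfl; simp at hd0)
    exact h.sign_lemma h₁ h₂ _ _ rfl hr (ih _ hr hrd).1 (ih _ hr hrd).2 _ _ (fun e _ => hcut e))
  exact hne e he

lemma MaxPair.alg (h : MaxPair ψ₁ ψ₂) (h₁ : PIVT K₁) (h₂ : PIVT K₂) (d : ℕ) :
    ∀ q : E[X], q ≠ 0 → q.natDegree < d →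
      (∀ t, (q.map ψ₁).eval t = 0 → ∃ e, ψ₁ e = t) ∧
      (∀ t, (q.map ψ₂).eval t = 0 → ∃ e, ψ₂ e = t) := by
  induction d with
  | zero => intro q _ hq; omega
  | succ d ih =>
    intro q hq hqd
    rcases Nat.lt_succ_iff_lt_or_eq.1 hqd with hlt | heq
    · exact ih q hq hlt
    · exact ⟨fun t ht => h.alg_step h₁ h₂ d ih q hq heq t ht, fun t ht =>
        h.symm.alg_step h₂ h₁ d (fun q h1 h2 => (ih q h1 h2).symm) q hq heq t ht⟩

lemma MaxPair.core (h : MaxPair ψ₁ ψ₂) (h₁ : PIVT K₁) (h₂ : PIVT K₂) (S : Finset E[X]) (t : K₁) :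
    ∃ t₂ : K₂, ∀ q ∈ S, SignType.sign ((q.map ψ₁).eval t) = SignType.sign ((q.map ψ₂).eval t₂) := by
  classical
  have : Nontrivial E := ψ₁.domain_nontrivial
  have hinj := h.inj
  have hinj2 := h.symm.inj
  have : IsDomain E := hinj.isDomain ψ₁
  by_cases hte : ∃ e, ψ₁ e = t
  · obtain ⟨e, rfl⟩ := hte
    exact ⟨ψ₂ e, fun q _ => by rw [eval_map_hom, eval_map_hom, h.sgn]⟩
  push Not at hte
  let R : Finset E := S.biUnion (fun q => q.roots.toFinset)
  obtain ⟨t₂, hlo, hhi⟩ := Order.exists_between_finsets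
    ((R.filter (fun e => ψ₁ e < t)).image ψ₂) ((R.filter (fun e => t < ψ₁ e)).image ψ₂) (by
      simp only [Finset.mem_image, Finset.mem_filter]
      rintro _ ⟨x, ⟨-, hx⟩, rfl⟩ _ ⟨y, ⟨-, hy⟩, rfl⟩
      exact (h.lt_iff _ _).1 (hx.trans hy))
  refine ⟨t₂, fun q hq => ?_⟩
  by_cases hq0 : q = 0
  · simp [hq0]
  have hq' := h.alg h₁ h₂ (q.natDegree + 1) q hq0 (Nat.lt_succ_self _)
  refine h.sign_lemma h₁ h₂ _ q rfl hq0 hq'.1 hq'.2 t t₂ (fun e he => ?_)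
  have heR : e ∈ R := by
    simp only [R, Finset.mem_biUnion, Multiset.mem_toFinset]
    exact ⟨q, hq, (mem_roots hq0).2 he⟩
  rcases lt_trichotomy (ψ₁ e) t with h3 | h3 | h3
  · rw [sign_pos (sub_pos.2 h3), sign_pos (sub_pos.2 (hlo _ (by
      simp only [Finset.mem_image, Finset.mem_filter]; exact ⟨e, ⟨heR, h3⟩, rfl⟩)))]
  · exact absurd h3 (hte e)
  · rw [sign_neg (sub_neg.2 h3), sign_neg (sub_neg.2 (hhi _ (by
      simp only [Finset.mem_image, Finset.mem_filter]; exact ⟨e, ⟨heR, h3⟩, rfl⟩)))]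

end Core

section Transfer
set_option linter.overlappingInstances false
open Polynomial

theorem core_transfer {A K₁ K₂ : Type*} [CommRing A]
    [Field K₁] [LinearOrder K₁] [IsStrictOrderedRing K₁]
    [Field K₂] [LinearOrder K₂] [IsStrictOrderedRing K₂]
    (h₁ : PIVT K₁) (h₂ : PIVT K₂) (φ₁ : A →+* K₁) (φ₂ : A →+* K₂)
    (hφ : ∀ a, SignType.sign (φ₁ a) = SignType.sign (φ₂ a)) (S : Finset A[X]) (t : K₁) :
    ∃ t₂ : K₂, ∀ q ∈ S, SignType.sign ((q.map φ₁).eval t)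
      = SignType.sign ((q.map φ₂).eval t₂) := by
  classical
  let good : Set (Subring (K₁ × K₂)) := {R | ∀ x ∈ R, SignType.sign x.1 = SignType.sign x.2}
  have h0 : (φ₁.prod φ₂).range ∈ good := by
    rintro _ ⟨a, rfl⟩; exact hφ a
  obtain ⟨E, hE0, hE⟩ := zorn_le_nonempty₀ good (by
    intro c hc hchain R hR
    refine ⟨sSup c, ?_, fun z hz => le_sSup hz⟩
    intro x hx
    rw [Subring.mem_sSup_of_directedOn ⟨R, hR⟩ hchain.directedOn] at hx
    obtain ⟨s, hs, hxs⟩ := hx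
    exact hc hs x hxs) _ h0
  have hgood : ∀ x ∈ E, SignType.sign x.1 = SignType.sign x.2 := hE.prop
  let ψ₁ : E →+* K₁ := (RingHom.fst K₁ K₂).comp E.subtype
  let ψ₂ : E →+* K₂ := (RingHom.snd K₁ K₂).comp E.subtype
  have hsgn : ∀ e, SignType.sign (ψ₁ e) = SignType.sign (ψ₂ e) := fun e => hgood e.1 e.2
  have hmax : ∀ t₁ t₂, (∀ q : E[X], SignType.sign ((q.map ψ₁).eval t₁)
      = SignType.sign ((q.map ψ₂).eval t₂)) → ∃ e, ψ₁ e = t₁ ∧ ψ₂ e = t₂ := by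
    intro t₁ t₂ hq
    let f : E[X] →+* K₁ × K₂ := (eval₂RingHom ψ₁ t₁).prod (eval₂RingHom ψ₂ t₂)
    have hle : E ≤ f.range := by
      intro x hx
      exact ⟨C ⟨x, hx⟩, by simp [f, ψ₁, ψ₂]⟩
    have hfg : f.range ∈ good := by
      rintro _ ⟨q, rfl⟩
      have := hq q
      simpa [f, eval_map] using this
    have hmem : (t₁, t₂) ∈ f.range := ⟨X, by simp [f]⟩
    have := hE.le_of_ge hfg hle hmem
    exact ⟨⟨_, this⟩, rfl, rfl⟩
  have hpair : MaxPair ψ₁ ψ₂ := by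
    refine ⟨hsgn, ?_, hmax⟩
    intro e he
    have h1 : ψ₁ e ≠ 0 := by
      intro h1
      have h2 : ψ₂ e = 0 := by rw [← sign_eq_zero_iff, ← hsgn, h1, sign_zero]
      exact he (Subtype.ext (Prod.ext h1 h2))
    have h2 : ψ₂ e ≠ 0 := by
      intro h2
      exact h1 (by rw [← sign_eq_zero_iff, hsgn, h2, sign_zero])
    obtain ⟨e', h3, h4⟩ := hmax (ψ₁ e)⁻¹ (ψ₂ e)⁻¹ (by
      intro q
      let i1 : Invertible (ψ₁ e)⁻¹ := ⟨ψ₁ e, mul_inv_cancel₀ h1, inv_mul_cancel₀ h1⟩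
      let i2 : Invertible (ψ₂ e)⁻¹ := ⟨ψ₂ e, mul_inv_cancel₀ h2, inv_mul_cancel₀ h2⟩
      have a1 : eval₂ ψ₁ (ψ₁ e) q.reverse * (ψ₁ e)⁻¹ ^ q.natDegree = eval₂ ψ₁ (ψ₁ e)⁻¹ q :=
        eval₂_reverse_mul_pow ψ₁ (ψ₁ e)⁻¹ q
      have a2 : eval₂ ψ₂ (ψ₂ e) q.reverse * (ψ₂ e)⁻¹ ^ q.natDegree = eval₂ ψ₂ (ψ₂ e)⁻¹ q :=
        eval₂_reverse_mul_pow ψ₂ (ψ₂ e)⁻¹ q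
      rw [eval_map, eval_map, ← a1, ← a2, sign_mul, sign_mul, sign_pow, sign_pow,
        eval₂_hom, eval₂_hom, hsgn]
      congr 2
      rcases lt_or_gt_of_ne h1 with h3 | h3
      · have h4 : ψ₂ e < 0 := by rw [← sign_eq_neg_one_iff, ← hsgn, sign_neg h3]
        rw [sign_neg (inv_lt_zero.2 h3), sign_neg (inv_lt_zero.2 h4)]
      · have h4 : 0 < ψ₂ e := by rw [← sign_eq_one_iff, ← hsgn, sign_pos h3]
        rw [sign_pos (inv_pos.2 h3), sign_pos (inv_pos.2 h4)])
    refine ⟨e', Subtype.ext (Prod.ext ?_ ?_)⟩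
    · change ψ₁ e * ψ₁ e' = 1
      rw [h3, mul_inv_cancel₀ h1]
    · change ψ₂ e * ψ₂ e' = 1
      rw [h4, mul_inv_cancel₀ h2]
  let j : A →+* E := (φ₁.prod φ₂).codRestrict E (fun a => hE0 ⟨a, rfl⟩)
  have j1 : ψ₁.comp j = φ₁ := rfl
  have j2 : ψ₂.comp j = φ₂ := rfl
  obtain ⟨t₂, ht₂⟩ := hpair.core h₁ h₂ (S.image (Polynomial.map j)) t
  refine ⟨t₂, fun q hq => ?_⟩
  have := ht₂ _ (Finset.mem_image_of_mem _ hq)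
  rwa [Polynomial.map_map, Polynomial.map_map, j1, j2] at this

theorem pivt_real : PIVT ℝ := by
  intro P a b hab h
  have hc : ContinuousOn (fun x => P.eval x) (Set.Icc a b) := P.continuous.continuousOn
  rcases mul_neg_iff.1 h with ⟨h1, h2⟩ | ⟨h1, h2⟩
  · obtain ⟨c, hc, h0⟩ := intermediate_value_Ioo' hab.le hc ⟨h2, h1⟩
    exact ⟨c, hc.1, hc.2, h0⟩
  · obtain ⟨c, hc, h0⟩ := intermediate_value_Ioo hab.le hc ⟨h1, h2⟩
    exact ⟨c, hc.1, hc.2, h0⟩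

noncomputable def germHom {ι : Type*} (U : Ultrafilter ι) : (ι → ℝ) →+* (U : Filter ι).Germ ℝ :=
  Filter.Germ.coeRingHom (U : Filter ι)

lemma germ_eval {ι : Type*} (U : Ultrafilter ι) (Q : (ι → ℝ)[X]) (y : ι → ℝ) :
    (Q.map (germHom U)).eval (germHom U y) =
      ((fun x => (Q.map (Pi.evalRingHom (fun _ => ℝ) x)).eval (y x) : ι → ℝ) :
        (U : Filter ι).Germ ℝ) := by
  rw [eval_map_hom]
  change ((Q.eval y : ι → ℝ) : (U : Filter ι).Germ ℝ) = _
  congr 1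
  funext x
  have := eval_map_hom (Pi.evalRingHom (fun _ => ℝ) x) Q y
  exact this.symm

theorem pivt_germ {ι : Type*} (U : Ultrafilter ι) : PIVT ((U : Filter ι).Germ ℝ) := by
  classical
  intro P a b hab h
  have hsurj : Function.Surjective (germHom U) := fun g => by
    induction g using Filter.Germ.inductionOn with
    | h f => exact ⟨f, rfl⟩
  obtain ⟨Q, rfl⟩ := Polynomial.map_surjective _ hsurj P
  obtain ⟨a, rfl⟩ := hsurj a
  obtain ⟨b, rfl⟩ := hsurj b
  rw [germ_eval, germ_eval] at h
  have hab' : ∀ᶠ x in (U : Filter ι), a x < b x := Filter.Germ.coe_lt.1 hab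
  have h' : ∀ᶠ x in (U : Filter ι), (Q.map (Pi.evalRingHom (fun _ => ℝ) x)).eval (a x)
      * (Q.map (Pi.evalRingHom (fun _ => ℝ) x)).eval (b x) < 0 := Filter.Germ.coe_lt.1 h
  have key : ∀ x, ∃ c, (a x < b x → (Q.map (Pi.evalRingHom (fun _ => ℝ) x)).eval (a x)
      * (Q.map (Pi.evalRingHom (fun _ => ℝ) x)).eval (b x) < 0 →
      a x < c ∧ c < b x ∧ (Q.map (Pi.evalRingHom (fun _ => ℝ) x)).eval c = 0) := by
    intro x
    by_cases h1 : a x < b x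
    · by_cases h2 : (Q.map (Pi.evalRingHom (fun _ => ℝ) x)).eval (a x)
        * (Q.map (Pi.evalRingHom (fun _ => ℝ) x)).eval (b x) < 0
      · obtain ⟨c, hc⟩ := pivt_real _ _ _ h1 h2
        exact ⟨c, fun _ _ => hc⟩
      · exact ⟨0, fun _ h => absurd h h2⟩
    · exact ⟨0, fun h => absurd h h1⟩
  choose c hc using key
  refine ⟨germHom U c, ?_, ?_, ?_⟩
  · apply Filter.Germ.coe_lt.2
    filter_upwards [hab', h'] with x h1 h2 using (hc x h1 h2).1
  · apply Filter.Germ.coe_lt.2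
    filter_upwards [hab', h'] with x h1 h2 using (hc x h1 h2).2.1
  · rw [germ_eval]
    apply Filter.Germ.coe_eq.2
    filter_upwards [hab', h'] with x h1 h2 using (hc x h1 h2).2.2

lemma germ_sign {ι : Type*} (U : Ultrafilter ι) (f : ι → ℝ) (s : SignType) :
    SignType.sign (germHom U f) = s ↔ ∀ᶠ x in (U : Filter ι), SignType.sign (f x) = s := by
  have hz : (0 : (U : Filter ι).Germ ℝ) = ((fun _ => 0 : ι → ℝ) : (U : Filter ι).Germ ℝ) := rfl
  rcases s with _ | _ | _
  · simp only [SignType.zero_eq_zero, sign_eq_zero_iff]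
    rw [hz]; exact Filter.Germ.coe_eq
  · simp only [SignType.neg_eq_neg_one, sign_eq_neg_one_iff]
    rw [hz]; exact Filter.Germ.coe_lt
  · simp only [SignType.pos_eq_one, sign_eq_one_iff]
    rw [hz]; exact Filter.Germ.coe_lt

theorem tarski_transfer (n : ℕ) : ∀ (K : Type) [Field K] [LinearOrder K] [IsStrictOrderedRing K]
    (_ : PIVT K) (φ : MvPolynomial (Fin n) ℝ →+* K) (S : Finset (MvPolynomial (Fin n) ℝ)),
    ∃ a : Fin n → ℝ, ∀ f ∈ S, SignType.sign (MvPolynomial.eval a f) = SignType.sign (φ f) := by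
  classical
  induction n with
  | zero =>
    intro K _ _ _ _ φ S
    refine ⟨fun i => i.elim0, fun f _ => ?_⟩
    rw [MvPolynomial.eq_C_of_isEmpty f]
    generalize MvPolynomial.coeff 0 f = r
    rw [MvPolynomial.eval_C]
    have hsq : ∀ r : ℝ, 0 < r → 0 < φ (MvPolynomial.C r) := by
      intro r hr
      have e : φ (MvPolynomial.C r) = φ (MvPolynomial.C (√r)) * φ (MvPolynomial.C (√r)) := by
        rw [← map_mul, ← map_mul, Real.mul_self_sqrt hr.le]
      rw [e]
      apply mul_self_pos.2
      have := (φ.comp MvPolynomial.C).injective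
      intro h0
      have := (map_eq_zero_iff (φ.comp MvPolynomial.C) this).1 h0
      exact (Real.sqrt_pos.2 hr).ne' this
    rcases lt_trichotomy r 0 with h | rfl | h
    · rw [sign_neg h, sign_neg]
      have := hsq (-r) (by linarith)
      rw [map_neg, map_neg] at this; linarith
    · simp
    · rw [sign_pos h, sign_pos (hsq r h)]
  | succ n ih =>
    intro K _ _ _ hK φ S
    let Φ := MvPolynomial.finSuccEquiv ℝ n
    let φ' : MvPolynomial (Fin n) ℝ →+* K := (φ.comp (Φ.symm : _ →+* _)).comp Polynomial.C
    let t : K := φ (Φ.symm Polynomial.X)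
    have hφ : ∀ q : (MvPolynomial (Fin n) ℝ)[X], (q.map φ').eval t = φ (Φ.symm q) := by
      intro q
      have : (evalRingHom t).comp (mapRingHom φ') = φ.comp (Φ.symm : _ →+* _) := by
        apply Polynomial.ringHom_ext
        · intro a; simp [φ']
        · simp [t]
      exact DFunLike.congr_fun this q
    let ι := Fin n → ℝ
    let 𝓕 : Filter ι := ⨅ f : MvPolynomial (Fin n) ℝ,
      Filter.principal {a | SignType.sign (MvPolynomial.eval a f) = SignType.sign (φ' f)}
    have hne : 𝓕.NeBot := by
      rw [Filter.neBot_iff]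
      intro hbot
      have := (Filter.mem_iInf_finite (f := fun f : MvPolynomial (Fin n) ℝ =>
        Filter.principal {a : ι | SignType.sign (MvPolynomial.eval a f) = SignType.sign (φ' f)}) ∅).1
        (by change ∅ ∈ 𝓕; rw [hbot]; trivial)
      obtain ⟨T, hT⟩ := this
      rw [Filter.iInf_principal_finset, Filter.mem_principal] at hT
      obtain ⟨a, ha⟩ := ih K hK φ' T
      exact hT (Set.mem_iInter₂.2 ha)
    let U : Ultrafilter ι := Ultrafilter.of 𝓕
    have hU : ∀ f, ∀ᶠ a in (U : Filter ι),
        SignType.sign (MvPolynomial.eval a f) = SignType.sign (φ' f) := by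
      intro f
      apply Ultrafilter.of_le 𝓕
      exact Filter.mem_iInf_of_mem f (Filter.mem_principal_self _)
    let ev : MvPolynomial (Fin n) ℝ →+* (ι → ℝ) := RingHom.pi (fun a => MvPolynomial.eval a)
    let φ₂ : MvPolynomial (Fin n) ℝ →+* (U : Filter ι).Germ ℝ := (germHom U).comp ev
    obtain ⟨t₂, ht₂⟩ := core_transfer hK (pivt_germ U) φ' φ₂ (fun f =>
      ((germ_sign U _ _).2 (hU f)).symm) (S.image Φ) t
    obtain ⟨τ, rfl⟩ : ∃ τ, germHom U τ = t₂ := by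
      induction t₂ using Filter.Germ.inductionOn with
      | h f => exact ⟨f, rfl⟩
    have hall : ∀ f ∈ S, ∀ᶠ a in (U : Filter ι),
        SignType.sign (MvPolynomial.eval (Fin.cons (τ a) a : Fin (n+1) → ℝ) f)
          = SignType.sign (φ f) := by
      intro f hf
      have h1 := ht₂ _ (Finset.mem_image_of_mem _ hf)
      rw [hφ, AlgEquiv.symm_apply_apply, ← Polynomial.map_map] at h1
      rw [eval_map_hom] at h1
      have h2 := (germ_sign U _ _).1 h1.symm
      filter_upwards [h2] with a ha
      rw [← ha, MvPolynomial.eval_eq_eval_mv_eval']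
      have := eval_map_hom (Pi.evalRingHom (fun _ => ℝ) a) (Polynomial.map ev (Φ f)) τ
      rw [Polynomial.map_map] at this
      exact congrArg _ this
    obtain ⟨a, ha⟩ := ((Filter.eventually_all_finset S).2 hall).exists
    exact ⟨_, ha⟩

end Transfer

section RealClosure
open Polynomial

/-- Cone generated by (the image of) `T` and squares of `K`. -/
def TK {A Ω : Type} [CommRing A] [Field Ω] (φ : A →+* Ω) (T : Subsemiring A) (K : Subfield Ω) :
    AddSubmonoid Ω :=
  AddSubmonoid.closure {x | ∃ t ∈ T, ∃ z ∈ K, x = φ t * (z * z)}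

variable {A Ω : Type} [CommRing A] [Field Ω] {φ : A →+* Ω} {T : Subsemiring A} {K : Subfield Ω}

lemma TK.gen {t : A} (ht : t ∈ T) {z : Ω} (hz : z ∈ K) : φ t * (z * z) ∈ TK φ T K :=
  AddSubmonoid.subset_closure ⟨t, ht, z, hz, rfl⟩

lemma TK.sq {z : Ω} (hz : z ∈ K) : z * z ∈ TK φ T K := by
  simpa using TK.gen (φ := φ) (one_mem T) hz

lemma TK.one : (1 : Ω) ∈ TK φ T K := by simpa using TK.sq (φ := φ) (T := T) (one_mem K)

lemma TK.mul {x y : Ω} (hx : x ∈ TK φ T K) (hy : y ∈ TK φ T K) : x * y ∈ TK φ T K := by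
  induction hx using AddSubmonoid.closure_induction with
  | zero => simp
  | add a b _ _ ha hb => rw [add_mul]; exact add_mem ha hb
  | mem x hx =>
    obtain ⟨t, ht, z, hz, rfl⟩ := hx
    induction hy using AddSubmonoid.closure_induction with
    | zero => simp
    | add a b _ _ ha hb => rw [mul_add]; exact add_mem ha hb
    | mem y hy =>
      obtain ⟨s, hs, w, hw, rfl⟩ := hy
      have := TK.gen (φ := φ) (mul_mem ht hs) (mul_mem hz hw)
      rw [map_mul] at this
      convert this using 1
      ring

lemma TK.le (hK : ∀ a, φ a ∈ K) {x : Ω} (hx : x ∈ TK φ T K) : x ∈ K := by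
  induction hx using AddSubmonoid.closure_induction with
  | zero => exact zero_mem _
  | add a b _ _ ha hb => exact add_mem ha hb
  | mem x hx =>
    obtain ⟨t, ht, z, hz, rfl⟩ := hx
    exact mul_mem (hK _) (mul_mem hz hz)

lemma TK.mono {L : Subfield Ω} (h : K ≤ L) : TK φ T K ≤ TK φ T L := by
  apply AddSubmonoid.closure_mono
  rintro _ ⟨t, ht, z, hz, rfl⟩
  exact ⟨t, ht, z, h hz, rfl⟩

/-- if x and -x are in the cone then x = 0 -/
lemma TK.zero_of (hn : (-1 : Ω) ∉ TK φ T K) (hK : ∀ a, φ a ∈ K) {x : Ω}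
    (h1 : x ∈ TK φ T K) (h2 : -x ∈ TK φ T K) : x = 0 := by
  by_contra hx
  apply hn
  have := TK.mul (TK.mul h1 h2) (TK.sq (φ := φ) (T := T) (inv_mem (TK.le hK h1)))
  convert this using 1
  field_simp

/-- Maximality of `K`. -/
structure MaxK (φ : A →+* Ω) (T : Subsemiring A) (K : Subfield Ω) : Prop where
  le : ∀ a, φ a ∈ K
  neg : (-1 : Ω) ∉ TK φ T K
  max : ∀ L : Subfield Ω, K ≤ L → (-1 : Ω) ∉ TK φ T L → L ≤ K

/-- adjoining an element -/
lemma MaxK.adjoin [IsAlgClosed Ω] (h : MaxK φ T K) {α : Ω} (hα : IsIntegral K α) (hαK : α ∉ K) :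
    (-1 : Ω) ∈ AddSubmonoid.closure
      {x | ∃ t ∈ T, ∃ f : K[X], x = φ t * (aeval α f * aeval α f)} := by
  by_contra hcon
  let L : Subfield Ω := (IntermediateField.adjoin K {α}).toSubfield
  have hKL : K ≤ L := fun x hx => by
    have := (IntermediateField.adjoin K {α}).algebraMap_mem ⟨x, hx⟩
    exact this
  have hαL : α ∈ L := IntermediateField.mem_adjoin_simple_self K α
  refine hαK (h.max L hKL ?_ hαL)
  intro hL
  apply hcon
  refine AddSubmonoid.closure_mono ?_ hL
  rintro _ ⟨t, ht, z, hz, rfl⟩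
  have hz' : z ∈ (IntermediateField.adjoin K {α}).toSubalgebra := hz
  rw [IntermediateField.adjoin_simple_toSubalgebra_of_isAlgebraic hα.isAlgebraic,
    Algebra.adjoin_singleton_eq_range_aeval] at hz'
  obtain ⟨f, hf⟩ := hz'
  exact ⟨t, ht, f, by rw [← hf]; rfl⟩

lemma MaxK.negMem [IsAlgClosed Ω] (h : MaxK φ T K) {a : Ω} (ha : a ∈ K)
    (hns : ∀ z ∈ K, z * z ≠ a) : -a ∈ TK φ T K := by
  obtain ⟨α, hα⟩ := IsAlgClosed.exists_pow_nat_eq a (n := 2) (by norm_num)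
  have hαK : α ∉ K := fun hk => hns α hk (by rw [← hα]; ring)
  have hintegral : IsIntegral K α := by
    refine ⟨X ^ 2 - C ⟨a, ha⟩, monic_X_pow_sub_C _ (by norm_num), ?_⟩
    simp [hα]
    exact sub_self a
  have := h.adjoin hintegral hαK
  have hlin : ∀ f : K[X], ∃ x ∈ K, ∃ y ∈ K, aeval α f = x + y * α := by
    intro f
    induction f using Polynomial.induction_on' with
    | add p q hp hq =>
      obtain ⟨x, hx, y, hy, e⟩ := hp
      obtain ⟨x', hx', y', hy', e'⟩ := hq
      exact ⟨x + x', add_mem hx hx', y + y', add_mem hy hy', by rw [map_add, e, e']; ring⟩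
    | monomial n c =>
      induction n with
      | zero => exact ⟨c, c.2, 0, zero_mem _, by simp; rfl⟩
      | succ n ih =>
        obtain ⟨x, hx, y, hy, e⟩ := ih
        refine ⟨a * y, mul_mem ha hy, x, hx, ?_⟩
        rw [← monomial_mul_X, map_mul, e, aeval_X, ← hα]; ring
  have key : ∀ x ∈ AddSubmonoid.closure
      {x | ∃ t ∈ T, ∃ f : K[X], x = φ t * (aeval α f * aeval α f)},
      ∃ s ∈ TK φ T K, ∃ s' ∈ TK φ T K, ∃ r ∈ K, x = s + a * s' + α * r := by
    intro x hx
    induction hx using AddSubmonoid.closure_induction with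
    | zero => exact ⟨0, zero_mem _, 0, zero_mem _, 0, zero_mem _, by simp⟩
    | add x y _ _ hx hy =>
      obtain ⟨s, hs, s', hs', r, hr, e⟩ := hx
      obtain ⟨u, hu, u', hu', v, hv, e'⟩ := hy
      exact ⟨s + u, add_mem hs hu, s' + u', add_mem hs' hu', r + v, add_mem hr hv, by
        rw [e, e']; ring⟩
    | mem x hx =>
      obtain ⟨t, ht, f, rfl⟩ := hx
      obtain ⟨x, hx, y, hy, e⟩ := hlin f
      refine ⟨_, TK.gen ht hx, _, TK.gen ht hy, φ t * (x * y + x * y),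
        mul_mem (h.le _) (add_mem (mul_mem hx hy) (mul_mem hx hy)), ?_⟩
      rw [e, ← hα]; ring
  obtain ⟨s, hs, s', hs', r, hr, e⟩ := key _ this
  have hr0 : r = 0 := by
    by_contra hr0
    apply hαK
    have : α = (-1 - s - a * s') * r⁻¹ := by field_simp; rw [e]; ring
    rw [this]
    exact mul_mem (sub_mem (sub_mem (neg_mem (one_mem _)) (TK.le h.le hs))
      (mul_mem ha (TK.le h.le hs'))) (inv_mem hr)
  rw [hr0] at e
  have hs0 : s' ≠ 0 := by
    rintro rfl
    apply h.neg
    rw [e]; simpa using hs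
  have : -a = ((1 + s) * s') * (s'⁻¹ * s'⁻¹) := by
    field_simp
    linear_combination e
  rw [this]
  exact TK.mul (TK.mul (add_mem TK.one hs) hs') (TK.sq (inv_mem (TK.le h.le hs')))

lemma MaxK.mem_or_neg [IsAlgClosed Ω] (h : MaxK φ T K) {a : Ω} (ha : a ∈ K) :
    a ∈ TK φ T K ∨ -a ∈ TK φ T K := by
  by_cases hs : ∃ z ∈ K, z * z = a
  · obtain ⟨z, hz, rfl⟩ := hs
    exact Or.inl (TK.sq hz)
  · push Not at hs
    exact Or.inr (h.negMem ha hs)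

noncomputable def MaxK.cone (h : MaxK φ T K) : RingCone K where
  carrier := {x | (x : Ω) ∈ TK φ T K}
  mul_mem' := fun ha hb => TK.mul ha hb
  one_mem' := TK.one
  add_mem' := fun ha hb => (TK φ T K).add_mem ha hb
  zero_mem' := (TK φ T K).zero_mem
  eq_zero_of_mem_of_neg_mem' := fun {a} h1 h2 => Subtype.ext (TK.zero_of h.neg h.le h1 h2)

lemma MaxK.mem_cone (h : MaxK φ T K) (x : K) : x ∈ h.cone ↔ (x : Ω) ∈ TK φ T K := Iff.rfl

theorem MaxK.exists_order [IsAlgClosed Ω] (h : MaxK φ T K) :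
    ∃ (_ : LinearOrder K) (_ : IsStrictOrderedRing K), ∀ x : K, 0 ≤ x ↔ (x : Ω) ∈ TK φ T K := by
  classical
  have : HasMemOrNegMem h.cone := ⟨fun a => h.mem_or_neg a.2⟩
  let _ : LinearOrder K := LinearOrder.mkOfAddGroupCone h.cone
  have _ : IsOrderedRing K := IsOrderedRing.mkOfCone h.cone
  refine ⟨inferInstance, IsOrderedRing.toIsStrictOrderedRing K, fun x => ?_⟩
  rw [← h.mem_cone]
  have : (0 ≤ x) ↔ x - 0 ∈ h.cone := Iff.rfl
  rw [this, sub_zero]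

lemma MaxK.exists_poly [IsAlgClosed Ω] (h : MaxK φ T K) {α : Ω} {P : K[X]} (hP : P.Monic)
    (hP1 : P ≠ 1) (hα : aeval α P = 0) (hαK : α ∉ K) :
    ∃ q : K[X], q.natDegree ≤ 2 * (P.natDegree - 1) ∧ aeval α q = -1 ∧
      ∀ c : K, ((q.eval c : K) : Ω) ∈ TK φ T K := by
  suffices H : ∀ x ∈ AddSubmonoid.closure
      {x | ∃ t ∈ T, ∃ f : K[X], x = φ t * (aeval α f * aeval α f)},
      ∃ q : K[X], q.natDegree ≤ 2 * (P.natDegree - 1) ∧ aeval α q = x ∧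
      ∀ c : K, ((q.eval c : K) : Ω) ∈ TK φ T K from H _ (h.adjoin ⟨P, hP, hα⟩ hαK)
  intro x hx
  induction hx using AddSubmonoid.closure_induction with
  | zero => exact ⟨0, by simp, by simp, fun c => by simp⟩
  | add x y _ _ hx hy =>
    obtain ⟨q, h1, h2, h3⟩ := hx
    obtain ⟨q', h1', h2', h3'⟩ := hy
    refine ⟨q + q', (natDegree_add_le _ _).trans (max_le h1 h1'), by rw [map_add, h2, h2'], ?_⟩
    intro c
    rw [eval_add]
    exact add_mem (h3 c) (h3' c)
  | mem x hx =>
    obtain ⟨t, ht, f, rfl⟩ := hx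
    have e : aeval α (f %ₘ P) = aeval α f := by
      conv_rhs => rw [← modByMonic_add_div f P]
      simp [hα]
    have hd := natDegree_modByMonic_lt f hP hP1
    refine ⟨C ⟨φ t, h.le t⟩ * ((f %ₘ P) * (f %ₘ P)), ?_, ?_, ?_⟩
    · refine (natDegree_C_mul_le _ _).trans (natDegree_mul_le.trans ?_)
      omega
    · rw [map_mul, map_mul, e, aeval_C]; rfl
    · intro c
      rw [eval_mul, eval_mul, eval_C]
      exact TK.gen ht (Subtype.mem _)

theorem MaxK.pivt [IsAlgClosed Ω] (h : MaxK φ T K) [LinearOrder K] [IsStrictOrderedRing K]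
    (hpos : ∀ x : K, 0 ≤ x ↔ (x : Ω) ∈ TK φ T K) : PIVT K := by
  suffices H : ∀ (d : ℕ) (P : K[X]), P.natDegree = d → ∀ a b : K, a < b →
      P.eval a * P.eval b < 0 → ∃ c, a < c ∧ c < b ∧ P.eval c = 0 from
    fun P a b hab hP => H _ P rfl a b hab hP
  intro d
  induction d using Nat.strong_induction_on with
  | _ d ih =>
  intro P hd a b hab hP
  have hP0 : P ≠ 0 := by rintro rfl; simp at hP
  have hPu : ¬ IsUnit P := by
    intro hu
    obtain ⟨r, -, rfl⟩ := isUnit_iff.1 hu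
    simp at hP
    exact absurd hP (not_lt.2 (mul_self_nonneg r))
  by_cases hirr : Irreducible P
  · obtain ⟨α, hα⟩ := IsAlgClosed.exists_aeval_eq_zero Ω P hirr.degree_pos.ne'
    by_cases hαK : α ∈ K
    · have hr : P.eval (⟨α, hαK⟩ : K) = 0 := by
        have : aeval (algebraMap K Ω ⟨α, hαK⟩) P = 0 := hα
        rw [aeval_algebraMap_apply, map_eq_zero] at this
        simpa using this
      generalize (⟨α, hαK⟩ : K) = c at hr
      obtain ⟨Q, rfl⟩ := dvd_iff_isRoot.2 hr
      rcases hirr.isUnit_or_isUnit rfl with hu | hu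
      · exact absurd hu (not_isUnit_X_sub_C c)
      · obtain ⟨r, -, rfl⟩ := isUnit_iff.1 hu
        refine ⟨c, ?_, ?_, by simp⟩
        all_goals
          by_contra hc
          push Not at hc
          simp at hP
          apply absurd hP (not_lt.2 _)
        · have : 0 ≤ r ^ 2 * ((a - c) * (b - c)) :=
            mul_nonneg (sq_nonneg _) (mul_nonneg (by linarith) (by linarith))
          linarith
        · have : 0 ≤ r ^ 2 * ((c - a) * (c - b)) :=
            mul_nonneg (sq_nonneg _) (mul_nonneg (by linarith) (by linarith))
          linarith
    · exfalso
      have hlc : P.leadingCoeff ≠ 0 := leadingCoeff_ne_zero.2 hP0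
      have hmon : (P * C P.leadingCoeff⁻¹).Monic := monic_mul_leadingCoeff_inv hP0
      have hdeg : (P * C P.leadingCoeff⁻¹).natDegree = d := by
        rw [natDegree_mul_C (inv_ne_zero hlc), hd]
      have hdpos : 0 < d := hd ▸ hirr.natDegree_pos
      obtain ⟨q, hq1, hq2, hq3⟩ := h.exists_poly hmon (by
        intro h1; rw [h1] at hdeg; simp at hdeg; omega) (by simp [hα]) hαK
      rw [hdeg] at hq1
      have hdvd : P ∣ 1 + q := by
        have h1 : minpoly K α = P * C P.leadingCoeff⁻¹ :=
          (minpoly.eq_of_irreducible hirr hα).symm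
        have h2 : minpoly K α ∣ 1 + q := minpoly.dvd K α (by simp [hq2])
        rw [h1] at h2
        exact (dvd_mul_right _ _).trans h2
      obtain ⟨g, hg⟩ := hdvd
      have hqc : ∀ c, 0 < 1 + q.eval c := fun c => by
        have := (hpos _).2 (hq3 c)
        linarith
      have hgc : ∀ c, 0 < P.eval c * g.eval c := fun c => by
        rw [← eval_mul, ← hg]; simpa using hqc c
      have hg0 : g ≠ 0 := by rintro rfl; simpa using hgc 0
      have hgd : g.natDegree < d := by
        have h1 : (1 + q).natDegree ≤ 2 * (d - 1) :=
          (natDegree_add_le _ _).trans (max_le (by simp) hq1)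
        rw [hg, natDegree_mul hP0 hg0] at h1
        omega
      have hgneg : g.eval a * g.eval b < 0 := by
        have h1 := mul_pos (hgc a) (hgc b)
        by_contra hcon
        push Not at hcon
        have := mul_nonpos_of_nonpos_of_nonneg hP.le hcon
        linarith
      obtain ⟨c, -, -, hc⟩ := ih _ hgd g rfl a b hab hgneg
      have := hgc c
      rw [hc] at this
      simp at this
  · rw [irreducible_iff] at hirr
    push Not at hirr
    obtain ⟨Q, R, rfl, hQ, hR⟩ := hirr hPu
    have hQ0 := left_ne_zero_of_mul hP0
    have hR0 := right_ne_zero_of_mul hP0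
    have hQd : Q.natDegree ≠ 0 := fun h0 => hQ (by
      obtain ⟨x, rfl⟩ := natDegree_eq_zero.1 h0
      exact isUnit_C.2 (IsUnit.mk0 _ (by simpa using hQ0)))
    have hRd : R.natDegree ≠ 0 := fun h0 => hR (by
      obtain ⟨x, rfl⟩ := natDegree_eq_zero.1 h0
      exact isUnit_C.2 (IsUnit.mk0 _ (by simpa using hR0)))
    rw [natDegree_mul hQ0 hR0] at hd
    have hprod : (Q.eval a * Q.eval b) * (R.eval a * R.eval b) < 0 := by
      simp only [eval_mul] at hP; linarith
    rcases mul_neg_iff.1 hprod with ⟨-, h2⟩ | ⟨h2, -⟩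
    · obtain ⟨c, h3, h4, h5⟩ := ih _ (by omega) R rfl a b hab h2
      exact ⟨c, h3, h4, by simp [h5]⟩
    · obtain ⟨c, h3, h4, h5⟩ := ih _ (by omega) Q rfl a b hab h2
      exact ⟨c, h3, h4, by simp [h5]⟩

lemma exists_maxK (φ : A →+* Ω) (T : Subsemiring A) (K : Subfield Ω) (hK : ∀ a, φ a ∈ K)
    (hn : (-1 : Ω) ∉ TK φ T K) : ∃ L, MaxK φ T L := by
  obtain ⟨L, hKL, hL⟩ := zorn_le_nonempty₀ {L : Subfield Ω | (-1 : Ω) ∉ TK φ T L} (by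
    intro c hc hchain R hR
    refine ⟨sSup c, ?_, fun z hz => le_sSup hz⟩
    have hdir := hchain.directedOn
    have key : ∀ x ∈ TK φ T (sSup c), ∃ L ∈ c, x ∈ TK φ T L := by
      intro x hx
      induction hx using AddSubmonoid.closure_induction with
      | zero => exact ⟨R, hR, zero_mem _⟩
      | add x y _ _ hx hy =>
        obtain ⟨L, hL, hx⟩ := hx
        obtain ⟨L', hL', hy⟩ := hy
        obtain ⟨M, hM, h1, h2⟩ := hdir L hL L' hL'
        exact ⟨M, hM, add_mem (TK.mono h1 hx) (TK.mono h2 hy)⟩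
      | mem x hx =>
        obtain ⟨t, ht, z, hz, rfl⟩ := hx
        rw [Subfield.mem_sSup_of_directedOn ⟨R, hR⟩ hdir] at hz
        obtain ⟨L, hL, hz⟩ := hz
        exact ⟨L, hL, TK.gen ht hz⟩
    intro hcon
    obtain ⟨L, hL, hx⟩ := key _ hcon
    exact hc hL hx) K hn
  exact ⟨L, fun a => hKL (hK a), hL.prop, fun M hM hMn => hL.le_of_ge hMn hM⟩

theorem exists_real_prime (T : Subsemiring A) (hsq : ∀ a, a * a ∈ T) (hneg : (-1 : A) ∉ T) :
    ∃ I : Ideal A, I.IsPrime ∧ ∀ b t, t ∈ T → b * b + t ∈ I → b ∈ I := by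
  obtain ⟨I, -, hI⟩ := zorn_le_nonempty₀ {I : Ideal A | ∀ t ∈ T, 1 + t ∉ I} (by
    intro c hc hchain R hR
    refine ⟨sSup c, ?_, fun z hz => le_sSup hz⟩
    intro t ht hx
    rw [Submodule.mem_sSup_of_directed ⟨R, hR⟩ hchain.directedOn] at hx
    obtain ⟨s, hs, hxs⟩ := hx
    exact hc hs t ht hxs) ⊥ (by
      intro t ht h0
      apply hneg
      rwa [← eq_neg_of_add_eq_zero_right (Ideal.mem_bot.1 h0)])
  have hIp : ∀ t ∈ T, 1 + t ∉ I := hI.prop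
  have hmax : ∀ a, a ∉ I → ∃ t ∈ T, ∃ c, 1 + t - a * c ∈ I := by
    intro a ha
    by_contra hcon
    push Not at hcon
    apply ha
    refine hI.le_of_ge (y := I ⊔ Ideal.span {a}) ?_ le_sup_left
      ((le_sup_right : _ ≤ I ⊔ Ideal.span {a}) (Ideal.mem_span_singleton_self a))
    intro t ht hmem
    obtain ⟨x, hx, y, hy, e⟩ := Submodule.mem_sup.1 hmem
    obtain ⟨c, rfl⟩ := Ideal.mem_span_singleton.1 hy
    apply hcon t ht c
    rw [← e]; simpa using hx
  refine ⟨I, ⟨?_, ?_⟩, ?_⟩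
  · intro htop
    exact hIp 0 (zero_mem _) (by rw [htop]; trivial)
  · intro a b hab
    by_contra hcon
    push Not at hcon
    obtain ⟨t, ht, c, h1⟩ := hmax a hcon.1
    obtain ⟨s, hs, d, h2⟩ := hmax b hcon.2
    apply hIp (t + s + t * s) (add_mem (add_mem ht hs) (mul_mem ht hs))
    have e : 1 + (t + s + t * s) = (1 + t - a * c) * (1 + s) + a * c * (1 + s - b * d)
      + (a * b) * (c * d) := by ring
    rw [e]
    exact add_mem (add_mem (I.mul_mem_right _ h1) (I.mul_mem_left _ h2)) (I.mul_mem_right _ hab)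
  · intro b t ht hbt
    by_contra hb
    obtain ⟨s, hs, c, h1⟩ := hmax b hb
    apply hIp (s + s + s * s + t * (c * c)) (add_mem (add_mem (add_mem hs hs) (mul_mem hs hs))
      (mul_mem ht (hsq c)))
    have e : 1 + (s + s + s * s + t * (c * c)) = (1 + s - b * c) * (1 + s + b * c)
      + (b * b + t) * (c * c) := by ring
    rw [e]
    exact add_mem (I.mul_mem_right _ h1) (I.mul_mem_right _ hbt)

theorem exists_real_closed (T : Subsemiring A) (hsq : ∀ a, a * a ∈ T) (hneg : (-1 : A) ∉ T) :
    ∃ (K : Type) (_ : Field K) (_ : LinearOrder K) (_ : IsStrictOrderedRing K) (φ : A →+* K),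
      PIVT K ∧ ∀ t ∈ T, 0 ≤ φ t := by
  obtain ⟨I, hI, hreal⟩ := exists_real_prime T hsq hneg
  let F := FractionRing (A ⧸ I)
  let Ω := AlgebraicClosure F
  let j : A ⧸ I →+* Ω := (algebraMap F Ω).comp (algebraMap (A ⧸ I) F)
  have hj : Function.Injective j :=
    (algebraMap F Ω).injective.comp (IsFractionRing.injective (A ⧸ I) F)
  let φ : A →+* Ω := j.comp (Ideal.Quotient.mk I)
  have hφ : ∀ a, φ a = 0 ↔ a ∈ I := fun a => by
    change j (Ideal.Quotient.mk I a) = 0 ↔ _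
    rw [map_eq_zero_iff j hj, Ideal.Quotient.eq_zero_iff_mem]
  let K₀ : Subfield Ω := (algebraMap F Ω).fieldRange
  have hK₀ : ∀ a, φ a ∈ K₀ := fun a => ⟨_, rfl⟩
  have hfrac : ∀ z ∈ K₀, ∃ a b, φ b ≠ 0 ∧ z * φ b = φ a := by
    rintro _ ⟨z, rfl⟩
    obtain ⟨a, b, hb, rfl⟩ := IsFractionRing.div_surjective (A := A ⧸ I) z
    obtain ⟨a, rfl⟩ := Ideal.Quotient.mk_surjective a
    obtain ⟨b, rfl⟩ := Ideal.Quotient.mk_surjective b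
    have hb0 : φ b ≠ 0 := by
      intro h0
      exact nonZeroDivisors.ne_zero hb ((map_eq_zero_iff j hj).1 h0)
    refine ⟨a, b, hb0, ?_⟩
    rw [map_div₀]
    exact div_mul_cancel₀ _ hb0
  have key : ∀ x ∈ TK φ T K₀, ∃ b, φ b ≠ 0 ∧ ∃ t ∈ T, x * (φ b * φ b) = φ t := by
    intro x hx
    induction hx using AddSubmonoid.closure_induction with
    | zero => exact ⟨1, by simp, 0, zero_mem _, by simp⟩
    | add x y _ _ hx hy =>
      obtain ⟨b, hb, t, ht, e⟩ := hx
      obtain ⟨b', hb', t', ht', e'⟩ := hy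
      refine ⟨b * b', by rw [map_mul]; exact mul_ne_zero hb hb',
        t * (b' * b') + t' * (b * b), add_mem (mul_mem ht (hsq _)) (mul_mem ht' (hsq _)), ?_⟩
      simp only [map_add, map_mul, ← e, ← e']; ring
    | mem x hx =>
      obtain ⟨t, ht, z, hz, rfl⟩ := hx
      obtain ⟨a, b, hb, e⟩ := hfrac z hz
      refine ⟨b, hb, t * (a * a), mul_mem ht (hsq _), ?_⟩
      simp only [map_mul, ← e]; ring
  have hn : (-1 : Ω) ∉ TK φ T K₀ := by
    intro hcon
    obtain ⟨b, hb, t, ht, e⟩ := key _ hcon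
    apply hb
    rw [hφ]
    apply hreal b t ht
    rw [← hφ, map_add, map_mul, ← e]; ring
  obtain ⟨K, hK⟩ := exists_maxK φ T K₀ hK₀ hn
  obtain ⟨o, so, hpos⟩ := hK.exists_order
  refine ⟨K, inferInstance, o, so, φ.codRestrict K hK.le, hK.pivt hpos, fun t ht => ?_⟩
  rw [hpos]
  have := TK.gen (φ := φ) (K := K) ht (one_mem K)
  simpa using this

end RealClosure

section QuadModules
set_option linter.unusedSectionVars false

/-- Quadratic modules of a commutative ring. -/
structure QM {R : Type} [CommRing R] (Q : Set R) : Prop where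
  one : 1 ∈ Q
  add : ∀ {a b}, a ∈ Q → b ∈ Q → a + b ∈ Q
  sq : ∀ (f : R) {q}, q ∈ Q → f * f * q ∈ Q

variable {R : Type} [CommRing R] [Algebra ℝ R] {Q : Set R}

lemma QM.zero (h : QM Q) : 0 ∈ Q := by simpa using h.sq 0 h.one

lemma QM.square (h : QM Q) (f : R) : f * f ∈ Q := by simpa using h.sq f h.one

lemma QM.nat (h : QM Q) (k : ℕ) : (k : R) ∈ Q := by
  induction k with
  | zero => simpa using h.zero
  | succ k ih => rw [Nat.cast_succ]; exact h.add ih h.one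

lemma QM.scale (h : QM Q) {r : ℝ} (hr : 0 ≤ r) {q : R} (hq : q ∈ Q) :
    algebraMap ℝ R r * q ∈ Q := by
  have := h.sq (algebraMap ℝ R (Real.sqrt r)) hq
  rwa [← map_mul, Real.mul_self_sqrt hr] at this

lemma QM.const (h : QM Q) {r : ℝ} (hr : 0 ≤ r) : algebraMap ℝ R r ∈ Q := by
  simpa using h.scale hr h.one

lemma QM.nmul (h : QM Q) (k : ℕ) {q : R} (hq : q ∈ Q) : (k : R) * q ∈ Q := by
  have := h.scale (Nat.cast_nonneg k : (0 : ℝ) ≤ k) hq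
  simpa using this

lemma QM.ndiv (h : QM Q) {k : ℕ} (hk : k ≠ 0) {q : R} (hq : (k : R) * q ∈ Q) : q ∈ Q := by
  have := h.scale (r := (k : ℝ)⁻¹) (by positivity) hq
  rwa [← mul_assoc, ← map_natCast (algebraMap ℝ R) k, ← map_mul, inv_mul_cancel₀ (by positivity),
    map_one, one_mul] at this

lemma QM.sos (h : QM Q) {s q : R} (hs : IsSumSq s) (hq : q ∈ Q) : s * q ∈ Q := by
  induction hs with
  | zero => simpa using h.zero
  | sq_add a _ ih => rw [add_mul]; exact h.add (h.sq a hq) ih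

/-- Bounded elements. -/
def Bdd (Q : Set R) (f : R) : Prop := ∃ k : ℕ, (k : R) - f ∈ Q ∧ (k : R) + f ∈ Q

lemma QM.bdd_neg {f : R} (hf : Bdd Q f) : Bdd Q (-f) := by
  obtain ⟨k, h1, h2⟩ := hf
  exact ⟨k, by simpa using h2, by simpa [sub_eq_add_neg] using h1⟩

lemma QM.bdd_add (h : QM Q) {f g : R} (hf : Bdd Q f) (hg : Bdd Q g) : Bdd Q (f + g) := by
  obtain ⟨k, h1, h2⟩ := hf
  obtain ⟨l, h3, h4⟩ := hg
  refine ⟨k + l, ?_, ?_⟩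
  · convert h.add h1 h3 using 1; push_cast; ring
  · convert h.add h2 h4 using 1; push_cast; ring

lemma QM.sq_bound (h : QM Q) {f : R} {k : ℕ} (hk : k ≠ 0) (h1 : (k : R) - f ∈ Q)
    (h2 : (k : R) + f ∈ Q) : (k : R) * k - f * f ∈ Q := by
  apply h.ndiv (k := 2 * k) (by omega)
  convert h.add (h.sq (k + f) h1) (h.sq (k - f) h2) using 1
  push_cast; ring

lemma QM.bdd_sq (h : QM Q) {f : R} (hf : Bdd Q f) : Bdd Q (f * f) := by
  obtain ⟨k, h1, h2⟩ := hf
  have h1' : ((k + 1 : ℕ) : R) - f ∈ Q := by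
    convert h.add h1 h.one using 1; push_cast; ring
  have h2' : ((k + 1 : ℕ) : R) + f ∈ Q := by
    convert h.add h2 h.one using 1; push_cast; ring
  refine ⟨(k + 1) * (k + 1), ?_, h.add (h.nat _) (h.square f)⟩
  have := h.sq_bound (by omega) h1' h2'
  push_cast at this ⊢
  exact this

lemma QM.bdd_mul (h : QM Q) {f g : R} (hf : Bdd Q f) (hg : Bdd Q g) : Bdd Q (f * g) := by
  have h4 : Bdd Q ((f + g) * (f + g) + -((f - g) * (f - g))) := by
    refine h.bdd_add (h.bdd_sq (h.bdd_add hf hg)) (QM.bdd_neg (h.bdd_sq ?_))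
    rw [sub_eq_add_neg]
    exact h.bdd_add hf (QM.bdd_neg hg)
  obtain ⟨k, h1, h2⟩ := h4
  refine ⟨k, h.ndiv (k := 4) (by norm_num) ?_, h.ndiv (k := 4) (by norm_num) ?_⟩
  · convert h.add h1 (h.nat (3 * k)) using 1; push_cast; ring
  · convert h.add h2 (h.nat (3 * k)) using 1; push_cast; ring

lemma QM.bdd_const (h : QM Q) (r : ℝ) : Bdd Q (algebraMap ℝ R r) := by
  obtain ⟨k, hk⟩ := exists_nat_ge |r|
  have := abs_le.1 hk
  refine ⟨k, ?_, ?_⟩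
  · rw [← map_natCast (algebraMap ℝ R) k, ← map_sub]
    exact h.const (by linarith)
  · rw [← map_natCast (algebraMap ℝ R) k, ← map_add]
    exact h.const (by linarith)

/-- The squared norm polynomial. -/
noncomputable def normSqPoly (n : ℕ) : MvPolynomial (Fin n) ℝ :=
  ∑ i, MvPolynomial.X i * MvPolynomial.X i

theorem QM.arch {n : ℕ} {Q : Set (MvPolynomial (Fin n) ℝ)} (h : QM Q) {N : ℕ}
    (hN : (N : MvPolynomial (Fin n) ℝ) - normSqPoly n ∈ Q) (f : MvPolynomial (Fin n) ℝ) :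
    Bdd Q f := by
  induction f using MvPolynomial.induction_on with
  | C r => exact h.bdd_const r
  | add f g hf hg => exact h.bdd_add hf hg
  | mul_X f i hf =>
    refine h.bdd_mul hf ?_
    have hs : ∀ s : Finset (Fin n),
        ∑ j ∈ s, (MvPolynomial.X j * MvPolynomial.X j : MvPolynomial (Fin n) ℝ) ∈ Q := by
      intro s
      induction s using Finset.induction_on with
      | empty => simpa using h.zero
      | insert a s ha ih => rw [Finset.sum_insert ha]; exact h.add (h.square _) ih
    have hx : (N : MvPolynomial (Fin n) ℝ) - MvPolynomial.X i * MvPolynomial.X i ∈ Q := by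
      have e := Finset.add_sum_erase Finset.univ
        (fun j => (MvPolynomial.X j * MvPolynomial.X j : MvPolynomial (Fin n) ℝ))
        (Finset.mem_univ i)
      convert h.add hN (hs (Finset.univ.erase i)) using 1
      rw [normSqPoly, ← e]; ring
    generalize (MvPolynomial.X i : MvPolynomial (Fin n) ℝ) = x at hx ⊢
    refine ⟨N + 1, h.ndiv (k := 4) (by norm_num) ?_, h.ndiv (k := 4) (by norm_num) ?_⟩
    · convert h.add (h.add (h.nmul 4 hx) (h.square (2 * x - 1))) (h.nat 3) using 1
      push_cast; ring
    · convert h.add (h.add (h.nmul 4 hx) (h.square (2 * x + 1))) (h.nat 3) using 1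
      push_cast; ring

/-- Adjoining an element to a preordering. -/
def extT {R : Type} [CommRing R] (T : Subsemiring R) (hsq : ∀ a, a * a ∈ T) (g : R) :
    Subsemiring R where
  carrier := {x | ∃ a ∈ T, ∃ b ∈ T, x = a + g * b}
  zero_mem' := ⟨0, zero_mem _, 0, zero_mem _, by simp⟩
  one_mem' := ⟨1, one_mem _, 0, zero_mem _, by simp⟩
  add_mem' := by
    rintro _ _ ⟨a, ha, b, hb, rfl⟩ ⟨c, hc, d, hd, rfl⟩
    exact ⟨a + c, add_mem ha hc, b + d, add_mem hb hd, by ring⟩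
  mul_mem' := by
    rintro _ _ ⟨a, ha, b, hb, rfl⟩ ⟨c, hc, d, hd, rfl⟩
    exact ⟨a * c + g * g * (b * d), add_mem (mul_mem ha hc) (mul_mem (hsq g) (mul_mem hb hd)),
      a * d + b * c, add_mem (mul_mem ha hd) (mul_mem hb hc), by ring⟩

lemma mem_extT {R : Type} [CommRing R] {T : Subsemiring R} {hsq : ∀ a, a * a ∈ T} {g x : R} :
    x ∈ extT T hsq g ↔ ∃ a ∈ T, ∃ b ∈ T, x = a + g * b := Iff.rfl

lemma le_extT {R : Type} [CommRing R] {T : Subsemiring R} {hsq : ∀ a, a * a ∈ T} {g x : R}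
    (hx : x ∈ T) : x ∈ extT T hsq g := ⟨x, hx, 0, zero_mem _, by simp⟩

lemma self_extT {R : Type} [CommRing R] {T : Subsemiring R} {hsq : ∀ a, a * a ∈ T} {g : R} :
    g ∈ extT T hsq g := ⟨0, zero_mem _, 1, one_mem _, by simp⟩

lemma qm_of_subsemiring {R : Type} [CommRing R] (T : Subsemiring R) (hsq : ∀ a, a * a ∈ T) :
    QM (T : Set R) where
  one := one_mem T
  add := fun ha hb => add_mem ha hb
  sq := fun f _ hq => mul_mem (hsq f) hq

theorem woermann {n : ℕ} (T : Subsemiring (MvPolynomial (Fin n) ℝ)) (hsq : ∀ a, a * a ∈ T)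
    (N : ℕ) (hneg : (-1) ∈ extT T hsq (normSqPoly n - (N : MvPolynomial (Fin n) ℝ))) :
    ∃ k : ℕ, (k : MvPolynomial (Fin n) ℝ) - normSqPoly n ∈ T := by
  obtain ⟨t', ht', t, ht, e⟩ := hneg
  have hS : normSqPoly n ∈ T := sum_mem fun i _ => hsq _
  generalize hSdef : normSqPoly n = S at *
  have hT := qm_of_subsemiring T hsq
  have hsq' : ∀ a, a * a ∈ extT T hsq ((N : MvPolynomial (Fin n) ℝ) - S) := fun a => le_extT (hsq a)
  obtain ⟨m, ⟨a, ha, b, hb, e2⟩, -⟩ := (qm_of_subsemiring _ hsq').arch (N := N)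
    (by rw [hSdef]; exact self_extT) t'
  have h1 : (1 + t') * (m - t') ∈ T := by
    have : (1 + t') * a + t * (((N : MvPolynomial (Fin n) ℝ) - S) * (N - S)) * b ∈ T :=
      add_mem (mul_mem (add_mem (one_mem _) ht') ha) (mul_mem (mul_mem ht (hsq _)) hb)
    convert this using 1
    rw [e2]
    linear_combination (-((N : MvPolynomial (Fin n) ℝ) - S) * b) * e
  have h2 : (m * m + 4 * m : ℕ) - 4 * t' ∈ (T : Set (MvPolynomial (Fin n) ℝ)) := by
    convert hT.add (hT.nmul 4 h1) (hsq (m - 2 * t')) using 1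
    push_cast; ring
  have h3 : ((N : MvPolynomial (Fin n) ℝ) - S) * (1 + t') ∈ T := by
    convert mul_mem ht (hsq ((N : MvPolynomial (Fin n) ℝ) - S)) using 1
    linear_combination (-((N : MvPolynomial (Fin n) ℝ) - S)) * e
  refine ⟨4 * N + N * (m * m + 4 * m), ?_⟩
  have h4 := hT.add (hT.nmul 4 (hT.add h3 (mul_mem ht' hS))) (hT.nmul N h2)
  change _ ∈ (T : Set (MvPolynomial (Fin n) ℝ))
  convert hT.add h4 (hT.nmul 3 hS) using 1
  push_cast; ring

/-- Infinitesimals with respect to `S`. -/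
def Infml (S : Set R) (g : R) : Prop :=
  ∀ ε : ℝ, 0 < ε → algebraMap ℝ R ε - g ∈ S ∧ algebraMap ℝ R ε + g ∈ S

lemma Infml.add (h : QM Q) {f g : R} (hf : Infml Q f) (hg : Infml Q g) : Infml Q (f + g) := by
  intro ε hε
  obtain ⟨h1, h2⟩ := hf (ε / 2) (by positivity)
  obtain ⟨h3, h4⟩ := hg (ε / 2) (by positivity)
  have e : algebraMap ℝ R ε = algebraMap ℝ R (ε / 2) + algebraMap ℝ R (ε / 2) := by
    rw [← map_add]; congr 1; ring
  refine ⟨?_, ?_⟩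
  · convert h.add h1 h3 using 1; rw [e]; ring
  · convert h.add h2 h4 using 1; rw [e]; ring

lemma Infml.neg {f : R} (hf : Infml Q f) : Infml Q (-f) := fun ε hε =>
  ⟨by simpa using (hf ε hε).2, by simpa [sub_eq_add_neg] using (hf ε hε).1⟩

lemma Infml.zero (h : QM Q) : Infml Q 0 := fun ε hε => by simpa using h.const hε.le

lemma Infml.smul (h : QM Q) {f : R} (hf : Infml Q f) (r : ℝ) :
    Infml Q (algebraMap ℝ R r * f) := by
  have pos : ∀ r : ℝ, 0 < r → Infml Q (algebraMap ℝ R r * f) := by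
    intro r hr ε hε
    obtain ⟨h1, h2⟩ := hf (ε / r) (by positivity)
    have e : algebraMap ℝ R ε = algebraMap ℝ R r * algebraMap ℝ R (ε / r) := by
      rw [← map_mul]; congr 1; field_simp
    rw [e, ← mul_sub, ← mul_add]
    exact ⟨h.scale hr.le h1, h.scale hr.le h2⟩
  rcases lt_trichotomy r 0 with hr | hr | hr
  · have := (pos (-r) (by linarith)).neg
    simpa using this
  · subst hr; simpa using Infml.zero h
  · exact pos r hr

lemma Infml.sq (h : QM Q) {f : R} (hf : Infml Q f) : Infml Q (f * f) := by
  intro ε hε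
  refine ⟨?_, h.add (h.const hε.le) (h.square f)⟩
  have hs : 0 < Real.sqrt ε := Real.sqrt_pos.2 hε
  obtain ⟨h1, h2⟩ := hf _ hs
  set k := algebraMap ℝ R (Real.sqrt ε) with hk
  have e : algebraMap ℝ R ε = k * k := by rw [hk, ← map_mul, Real.mul_self_sqrt hε.le]
  have h3 := h.scale (r := (2 * Real.sqrt ε)⁻¹) (by positivity)
    (h.add (h.sq (k + f) h1) (h.sq (k - f) h2))
  convert h3 using 1
  have e2 : (k + f) * (k + f) * (k - f) + (k - f) * (k - f) * (k + f)
      = algebraMap ℝ R (2 * Real.sqrt ε) * (k * k - f * f) := by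
    rw [map_mul, ← hk, map_ofNat]; ring
  rw [e2, ← mul_assoc, ← map_mul, inv_mul_cancel₀ (by positivity), map_one, one_mul, e]

lemma Infml.mul (h : QM Q) {f g : R} (hf : Infml Q f) (hg : Infml Q g) : Infml Q (f * g) := by
  have h1 := (Infml.sq h (hf.add h hg)).add h (Infml.sq h (hf.add h hg.neg)).neg
  have h2 := Infml.smul h h1 (1 / 4)
  convert h2 using 1
  have : (f + g) * (f + g) + -((f + -g) * (f + -g)) = algebraMap ℝ R 4 * (f * g) := by
    rw [map_ofNat]; ring
  rw [this, ← mul_assoc, ← map_mul]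
  norm_num

/-- A proper quadratic module has no negative constants. -/
lemma QM.no_neg (h : QM Q) (hn : (-1 : R) ∉ Q) {r : ℝ} (hr : algebraMap ℝ R r ∈ Q) : 0 ≤ r := by
  by_contra hcon
  push Not at hcon
  apply hn
  have := h.scale (r := (-r)⁻¹) (by rw [inv_nonneg]; linarith) hr
  rw [← map_mul] at this
  convert this using 1
  rw [inv_neg, neg_mul, inv_mul_cancel₀ hcon.ne, map_neg, map_one]

lemma QM.exists_std (h : QM Q) (hn : (-1 : R) ∉ Q) (htot : ∀ a, a ∈ Q ∨ -a ∈ Q) {f : R}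
    (hf : Bdd Q f) : ∃ l : ℝ, Infml Q (f - algebraMap ℝ R l) := by
  obtain ⟨k, h1, h2⟩ := hf
  let s : Set ℝ := {r | f - algebraMap ℝ R r ∈ Q}
  have hne : s.Nonempty := ⟨-k, by
    change f - algebraMap ℝ R (-k) ∈ Q
    simpa [add_comm] using h2⟩
  have hbd : BddAbove s := ⟨k, by
    intro r hr
    have := h.no_neg hn (r := k - r) (by
      convert h.add h1 hr using 1
      rw [map_sub, map_natCast]; ring)
    linarith⟩
  refine ⟨sSup s, fun ε hε => ⟨?_, ?_⟩⟩
  · rcases htot (f - algebraMap ℝ R (sSup s + ε)) with h3 | h3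
    · have := le_csSup hbd (show sSup s + ε ∈ s from h3)
      linarith
    · convert h3 using 1; rw [map_add]; ring
  · obtain ⟨r, hr, hlt⟩ := exists_lt_of_lt_csSup hne (show sSup s - ε < sSup s by linarith)
    have hr' : f - algebraMap ℝ R r ∈ Q := hr
    have := h.add hr' (h.const (r := r - (sSup s - ε)) (by linarith))
    convert this using 1
    rw [map_sub, map_sub]; ring

lemma QM.exists_max (h : QM Q) (hn : (-1 : R) ∉ Q) :
    ∃ S, Q ⊆ S ∧ QM S ∧ (-1 : R) ∉ S ∧ ∀ a, a ∈ S ∨ -a ∈ S := by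
  obtain ⟨S, hQS, hS⟩ := zorn_subset_nonempty {S : Set R | QM S ∧ (-1 : R) ∉ S} (by
    intro c hc hchain hne
    refine ⟨⋃₀ c, ⟨⟨?_, ?_, ?_⟩, ?_⟩, fun s hs => Set.subset_sUnion_of_mem hs⟩
    · obtain ⟨s, hs⟩ := hne
      exact ⟨s, hs, (hc hs).1.one⟩
    · rintro a b ⟨s, hs, ha⟩ ⟨t, ht, hb⟩
      rcases hchain.total hs ht with hst | hst
      · exact ⟨t, ht, (hc ht).1.add (hst ha) hb⟩
      · exact ⟨s, hs, (hc hs).1.add ha (hst hb)⟩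
    · rintro f q ⟨s, hs, hq⟩
      exact ⟨s, hs, (hc hs).1.sq f hq⟩
    · rintro ⟨s, hs, hq⟩
      exact (hc hs).2 hq) Q ⟨h, hn⟩
  obtain ⟨hSq, hSn⟩ := hS.prop
  have hext : ∀ a, a ∉ S → ∃ s ∈ S, ∃ σ, IsSumSq σ ∧ -1 = s + σ * a := by
    intro a ha
    by_contra hcon
    push Not at hcon
    apply ha
    have hmem : {x | ∃ s ∈ S, ∃ σ, IsSumSq σ ∧ x = s + σ * a} ∈ {S : Set R | QM S ∧ (-1 : R) ∉ S} := by
      refine ⟨⟨⟨1, hSq.one, 0, .zero, by simp⟩, ?_, ?_⟩, ?_⟩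
      · rintro _ _ ⟨s, hs, σ, hσ, rfl⟩ ⟨s', hs', σ', hσ', rfl⟩
        exact ⟨s + s', hSq.add hs hs', σ + σ', hσ.add hσ', by ring⟩
      · rintro f _ ⟨s, hs, σ, hσ, rfl⟩
        exact ⟨f * f * s, hSq.sq f hs, f * f * σ, (IsSumSq.mul_self f).mul hσ, by ring⟩
      · rintro ⟨s, hs, σ, hσ, e⟩
        exact hcon s hs σ hσ e
    exact hS.le_of_ge hmem (fun s hs => ⟨s, hs, 0, .zero, by simp⟩)
      ⟨0, hSq.zero, 1, by simpa using IsSumSq.mul_self (1 : R), by simp⟩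
  refine ⟨S, hQS, hSq, hSn, fun a => ?_⟩
  by_contra hcon
  push Not at hcon
  obtain ⟨s, hs, σ, hσ, e⟩ := hext a hcon.1
  obtain ⟨s', hs', σ', hσ', e'⟩ := hext (-a) hcon.2
  have hσ'S : σ' ∈ S := by simpa using hSq.sos hσ' hSq.one
  have hσS : σ ∈ S := by simpa using hSq.sos hσ hSq.one
  have hσ'n : -σ' ∈ S := by
    have := hSq.add (hSq.sos hσ' hs) (hSq.add hσS (hSq.sos hσ hs'))
    convert this using 1
    linear_combination σ' * e + σ * e'
  have hmul : ∀ f, f * σ' ∈ S := by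
    intro f
    apply hSq.ndiv (k := 4) (by norm_num)
    convert hSq.add (hSq.sq (f + 1) hσ'S) (hSq.sq (f - 1) hσ'n) using 1
    push_cast; ring
  apply hSn
  have := hSq.add hs' (hmul (-a))
  convert this using 1
  rw [e']; ring

theorem QM.exists_point {n : ℕ} {Q : Set (MvPolynomial (Fin n) ℝ)} (h : QM Q)
    (hn : -1 ∉ Q) (harch : ∀ f, Bdd Q f) :
    ∃ x : Fin n → ℝ, ∀ f ∈ Q, 0 ≤ MvPolynomial.eval x f := by
  obtain ⟨S, hQS, hS, hSn, htot⟩ := h.exists_max hn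
  have hb : ∀ f, Bdd S f := fun f => by
    obtain ⟨k, h1, h2⟩ := harch f
    exact ⟨k, hQS h1, hQS h2⟩
  choose x hx using fun i : Fin n => hS.exists_std hSn htot (hb (MvPolynomial.X i))
  have hinf : ∀ f : MvPolynomial (Fin n) ℝ,
      Infml S (f - algebraMap ℝ _ (MvPolynomial.eval x f)) := by
    intro f
    induction f using MvPolynomial.induction_on with
    | C r =>
      have := Infml.zero hS
      rw [MvPolynomial.eval_C, MvPolynomial.algebraMap_eq, sub_self]
      exact this
    | add f g hf hg =>
      have := Infml.add hS hf hg
      convert this using 1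
      rw [map_add, map_add]; ring
    | mul_X f i hf =>
      have hi := hx i
      have := ((Infml.mul hS hf hi).add hS (hi.smul hS (MvPolynomial.eval x f))).add hS
        (hf.smul hS (x i))
      convert this using 1
      rw [map_mul, map_mul, MvPolynomial.eval_X]; ring
  refine ⟨x, fun f hf => ?_⟩
  by_contra hcon
  push Not at hcon
  have h1 := hS.add (hinf f (-MvPolynomial.eval x f / 2) (by linarith)).1 (hQS hf)
  have := hS.no_neg hSn (r := MvPolynomial.eval x f / 2) (by
    convert h1 using 1
    have : -MvPolynomial.eval x f / 2 = MvPolynomial.eval x f / 2 - MvPolynomial.eval x f := by ring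
    rw [this, map_sub]; ring)
  linarith

lemma QM.jacobi (h : QM Q) (harch : ∀ f, Bdd Q f) {p σ q : R} (hσ : IsSumSq σ) (hq : q ∈ Q)
    (e : -1 = q + σ * (-p)) : p ∈ Q := by
  have hσQ : σ ∈ Q := by simpa using h.sos hσ h.one
  obtain ⟨k₁, h1, -⟩ := harch σ
  obtain ⟨k₂, h2, -⟩ := harch (σ * σ * p + 1)
  obtain ⟨k, hk, hk1, hk2⟩ : ∃ k : ℕ, k ≠ 0 ∧ (2 * k : R) - σ ∈ Q ∧
      (2 * k : R) - σ * σ * p - 1 ∈ Q := by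
    refine ⟨k₁ + k₂ + 1, by omega, ?_, ?_⟩
    · convert h.add h1 (h.nat (k₁ + 2 * k₂ + 2)) using 1; push_cast; ring
    · convert h.add h2 (h.nat (2 * k₁ + k₂ + 2)) using 1; push_cast; ring
  have hk3 : σ * (2 * k - σ) ∈ Q := by
    apply h.ndiv (k := 2 * k) (by omega)
    convert h.add (h.sq (2 * k - σ) hσQ) (h.sq σ hk1) using 1
    push_cast; ring
  have step : ∀ j : ℕ, (k * k : R) * p + (j + 1 : ℕ) ∈ Q → (k * k : R) * p + j ∈ Q := by
    intro j hj
    apply h.ndiv (k := k * k) (by positivity)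
    have := h.add (h.add (h.sq (k - σ) hj) (h.nmul (k * k * (2 * k)) hq))
      (h.add (h.nmul (j + 1) hk3) (h.nmul (k * k) hk2))
    convert this using 1
    push_cast
    linear_combination ((k : R) * k * (2 * k)) * e
  have hall : ∀ j : ℕ, (k * k : R) * p + j ∈ Q → (k * k : R) * p ∈ Q := by
    intro j
    induction j with
    | zero => intro hj; simpa using hj
    | succ j ih => intro hj; exact ih (step j hj)
  obtain ⟨j, -, hj⟩ := harch ((k * k : R) * p)
  have := hall j (by rwa [add_comm])
  apply h.ndiv (k := k * k) (by positivity)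
  push_cast
  exact this

theorem QM.putinar {n : ℕ} {Q : Set (MvPolynomial (Fin n) ℝ)} (h : QM Q)
    (harch : ∀ f, Bdd Q f) (p : MvPolynomial (Fin n) ℝ)
    (hp : ∀ x : Fin n → ℝ, (∀ f ∈ Q, 0 ≤ MvPolynomial.eval x f) → 0 < MvPolynomial.eval x p) :
    p ∈ Q := by
  by_cases hn : ∃ q ∈ Q, ∃ σ, IsSumSq σ ∧ -1 = q + σ * (-p)
  · obtain ⟨q, hq, σ, hσ, e⟩ := hn
    exact h.jacobi harch hσ hq e
  · exfalso
    let Q' : Set (MvPolynomial (Fin n) ℝ) := {x | ∃ q ∈ Q, ∃ σ, IsSumSq σ ∧ x = q + σ * (-p)}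
    have hsub : ∀ x ∈ Q, x ∈ Q' := fun s hs => ⟨s, hs, 0, .zero, by simp⟩
    have hQ' : QM Q' := by
      refine ⟨hsub _ h.one, ?_, ?_⟩
      · rintro _ _ ⟨s, hs, σ, hσ, rfl⟩ ⟨s', hs', σ', hσ', rfl⟩
        exact ⟨s + s', h.add hs hs', σ + σ', hσ.add hσ', by ring⟩
      · rintro f _ ⟨s, hs, σ, hσ, rfl⟩
        exact ⟨f * f * s, h.sq f hs, f * f * σ, (IsSumSq.mul_self f).mul hσ, by ring⟩
    obtain ⟨x, hx⟩ := hQ'.exists_point hn (fun f => by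
      obtain ⟨k, h1, h2⟩ := harch f
      exact ⟨k, hsub _ h1, hsub _ h2⟩)
    have h1 := hp x fun f hf => hx f (hsub f hf)
    have h2 := hx (-p) ⟨0, h.zero, 1, by simpa using IsSumSq.mul_self (1 : MvPolynomial (Fin n) ℝ),
      by simp⟩
    rw [map_neg] at h2
    linarith

end QuadModules

lemma isSOS_iff {n : ℕ} (p : MvPolynomial (Fin n) ℝ) : IsSOS p ↔ IsSumSq p := by
  constructor
  · rintro ⟨r, h, rfl⟩
    refine IsSumSq.sum fun i _ => ?_
    rw [pow_two]
    exact IsSumSq.mul_self _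
  · intro h
    induction h with
    | zero => exact ⟨0, Fin.elim0, by simp⟩
    | sq_add a _ ih =>
      obtain ⟨r, h, rfl⟩ := ih
      exact ⟨r + 1, Fin.cons a h, by rw [Fin.sum_univ_succ]; simp [pow_two]⟩

lemma exists_arch {n : ℕ} {Q : Set (MvPolynomial (Fin n) ℝ)} (h : QM Q)
    {w : MvPolynomial (Fin n) ℝ} (hw : w ∈ Q)
    (hc : IsCompact {x : Fin n → ℝ | 0 ≤ MvPolynomial.eval x w}) :
    ∃ k : ℕ, (k : MvPolynomial (Fin n) ℝ) - normSqPoly n ∈ Q := by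
  obtain ⟨B, hB⟩ := hc.bddAbove_image (f := fun x => MvPolynomial.eval x (normSqPoly n))
    (MvPolynomial.continuous_eval _).continuousOn
  obtain ⟨N, hN⟩ := exists_nat_gt B
  have hlt : ∀ x : Fin n → ℝ, 0 ≤ MvPolynomial.eval x w →
      MvPolynomial.eval x (normSqPoly n) < N := fun x hx =>
    lt_of_le_of_lt (hB ⟨x, hx, rfl⟩) hN
  have hsq0 : ∀ a, a * a ∈ Subsemiring.sumSq (MvPolynomial (Fin n) ℝ) := fun a =>
    Subsemiring.mem_sumSq.2 (IsSumSq.mul_self a)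
  let T := extT (Subsemiring.sumSq (MvPolynomial (Fin n) ℝ)) hsq0 w
  have hsq : ∀ a, a * a ∈ T := fun a => le_extT (hsq0 a)
  have hTQ : ∀ t ∈ T, t ∈ Q := by
    rintro _ ⟨a, ha, b, hb, rfl⟩
    have h1 := h.sos (Subsemiring.mem_sumSq.1 ha) h.one
    have h2 := h.sos (Subsemiring.mem_sumSq.1 hb) hw
    rw [mul_one] at h1
    rw [mul_comm] at h2
    exact h.add h1 h2
  have hneg : (-1) ∈ extT T hsq (normSqPoly n - (N : MvPolynomial (Fin n) ℝ)) := by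
    by_contra hcon
    obtain ⟨K, _, _, _, φ, hK, hφ⟩ := exists_real_closed _ (fun a => le_extT (hsq a)) hcon
    obtain ⟨a, ha⟩ := tarski_transfer n K hK φ {w, normSqPoly n - (N : MvPolynomial (Fin n) ℝ)}
    have key : ∀ f ∈ extT T hsq (normSqPoly n - (N : MvPolynomial (Fin n) ℝ)),
        f ∈ ({w, normSqPoly n - (N : MvPolynomial (Fin n) ℝ)} : Finset _) →
        0 ≤ MvPolynomial.eval a f := by
      intro f hf hfm
      have h1 := ha f hfm
      have h2 := hφ f hf
      rw [← sign_nonneg_iff] at h2 ⊢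
      rwa [h1]
    have h1 := key w (le_extT self_extT) (by simp)
    have h2 := key _ self_extT (by simp)
    have h3 := hlt a h1
    rw [map_sub, map_natCast] at h2
    linarith
  obtain ⟨k, hk⟩ := woermann T hsq N hneg
  exact ⟨k, hTQ _ hk⟩

/-- **Putinar's Positivstellensatz** (Theorem 2 of the paper). Let
`K = {x : u_1 x ≥ 0, …, u_m x ≥ 0}` be compact and let `M` be the quadratic
module generated by `u_1, …, u_m`. If `M` contains a polynomial `u` with
`{x : u x ≥ 0}` compact, then every polynomial `p` that is strictly positive
on `K` lies in `M`. -/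
theorem putinar_positivstellensatz {n m : ℕ}
    (u : Fin m → MvPolynomial (Fin n) ℝ)
    (K : Set (Fin n → ℝ))
    (hKdef : K = {x | ∀ j, 0 ≤ MvPolynomial.eval x (u j)})
    (hKcompact : IsCompact K)
    (M : Set (MvPolynomial (Fin n) ℝ))
    (hMdef : M = {q | ∃ (σ₀ : MvPolynomial (Fin n) ℝ)
        (σ : Fin m → MvPolynomial (Fin n) ℝ),
        IsSOS σ₀ ∧ (∀ j, IsSOS (σ j)) ∧ q = σ₀ + ∑ j, σ j * u j})
    (harch : ∃ w ∈ M, IsCompact {x : Fin n → ℝ | 0 ≤ MvPolynomial.eval x w})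
    (p : MvPolynomial (Fin n) ℝ)
    (hp : ∀ x ∈ K, 0 < MvPolynomial.eval x p) :
    p ∈ M := by
  simp only [isSOS_iff] at hMdef
  have hM : QM M := by
    subst hMdef
    refine ⟨⟨1, fun _ => 0, by simp, fun _ => .zero, by simp⟩, ?_, ?_⟩
    · rintro _ _ ⟨a, s, ha, hs, rfl⟩ ⟨b, t, hb, ht, rfl⟩
      refine ⟨a + b, fun j => s j + t j, ha.add hb, fun j => (hs j).add (ht j), ?_⟩
      simp only [add_mul, Finset.sum_add_distrib]; ring
    · rintro f _ ⟨a, s, ha, hs, rfl⟩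
      refine ⟨f * f * a, fun j => f * f * s j, (IsSumSq.mul_self f).mul ha,
        fun j => (IsSumSq.mul_self f).mul (hs j), ?_⟩
      simp only [mul_add, Finset.mul_sum, mul_assoc]
  have hu : ∀ j, u j ∈ M := by
    intro j
    subst hMdef
    refine ⟨0, fun i => if i = j then 1 else 0, .zero, fun i => ?_, by simp⟩
    dsimp only
    split_ifs <;> simp
  obtain ⟨w, hw, hc⟩ := harch
  obtain ⟨k, hk⟩ := exists_arch hM hw hc
  refine hM.putinar (hM.arch hk) p fun x hx => hp x ?_
  rw [hKdef]
  exact fun j => hx _ (hu j)
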